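/- arXiv:1304.2847 — 15 statements merged into one kernel-verified Lean document; each statement's English description precedes it below -/
import Mathlib

section
/- Under the stated assumptions (all σᵢ nonzero, so Σ₁ is invertible, and A₁ of full column rank), the covariance matrix of the ordinary least squares estimator based on n+1 uncorrelated observations decomposes as V₁₁ = V₀₀ − σ_{n+1}²·W − W₁₁. -/
open Matrix

theorem inv_mul_add_smul_self_mul_inv {m R : Type*} [Fintype m] [DecidableEq m] [CommRing R]
    {M : Matrix m m R} (hM : IsUnit M.det) {B : Matrix m m R} {s : R} :
    M⁻¹ * (B + s • M) * M⁻¹ = M⁻¹ * B * M⁻¹ + s • M⁻¹ := by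
  rw [Matrix.mul_add, Matrix.add_mul, Matrix.mul_smul, Matrix.nonsing_inv_mul _ hM,
    Matrix.smul_mul, Matrix.one_mul]

/-- The Sherman–Morrison formula, for a rank-one update by a column times a row. -/
theorem inv_add_mul_row {m K : Type*} [Fintype m] [DecidableEq m] [Field K]
    {M : Matrix m m K} {u : Matrix m (Fin 1) K} {v : Matrix (Fin 1) m K}
    (hM : IsUnit M.det) (hMuv : IsUnit (M + u * v).det) :
    (M + u * v)⁻¹ = M⁻¹ - (1 / (1 + (v * M⁻¹ * u) 0 0)) • (M⁻¹ * u * v * M⁻¹) := by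
  have hq : 1 + (v * M⁻¹ * u) 0 0 ≠ 0 := by
    have hfac : M + u * v = M * (1 + M⁻¹ * u * v) := by
      rw [Matrix.mul_add, Matrix.mul_one, Matrix.mul_assoc M⁻¹,
        Matrix.mul_nonsing_inv_cancel_left _ _ hM]
    rw [hfac, Matrix.det_mul, Matrix.det_one_add_mul_comm, Matrix.det_fin_one,
      ← Matrix.mul_assoc] at hMuv
    simpa using (isUnit_of_mul_isUnit_right hMuv).ne_zero
  have hd : v * M⁻¹ * u = (v * M⁻¹ * u) 0 0 • (1 : Matrix (Fin 1) (Fin 1) K) := by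
    ext i j
    fin_cases i
    fin_cases j
    simp
  have hcross : u * v * (M⁻¹ * u * v * M⁻¹) = (v * M⁻¹ * u) 0 0 • (u * v * M⁻¹) := by
    calc u * v * (M⁻¹ * u * v * M⁻¹) = u * (v * M⁻¹ * u) * (v * M⁻¹) := by
          simp only [Matrix.mul_assoc]
      _ = (v * M⁻¹ * u) 0 0 • (u * v * M⁻¹) := by
          rw [hd]
          simp [Matrix.mul_assoc]
  have hself : M * (M⁻¹ * u * v * M⁻¹) = u * v * M⁻¹ := by
    simp only [Matrix.mul_assoc, Matrix.mul_nonsing_inv_cancel_left _ _ hM]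
  apply Matrix.inv_eq_right_inv
  rw [Matrix.mul_sub, Matrix.mul_smul, Matrix.add_mul, Matrix.add_mul, hself, hcross,
    Matrix.mul_nonsing_inv _ hM, ← one_smul K (u * v * M⁻¹), smul_smul, mul_one, ← add_smul, smul_smul,
    one_div_mul_cancel hq, add_sub_cancel_right]

/-- Proposition 2.1, decomposition of the OLS covariance:
`V₁₁ = V₀₀ − σ_{n+1}² • W − W₁₁`. -/
theorem ols_variance_decomposition
    (n k : ℕ) (hn : 1 ≤ n) (hk : 1 ≤ k)
    (A₀ : Matrix (Fin n) (Fin k) ℝ) (a : Matrix (Fin 1) (Fin k) ℝ)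
    (A₁ : Matrix (Fin (n + 1)) (Fin k) ℝ)
    (hA₁cast : ∀ (i : Fin n) (j : Fin k), A₁ (Fin.castSucc i) j = A₀ i j)
    (hA₁last : ∀ j : Fin k, A₁ (Fin.last n) j = a 0 j)
    (σ : Fin (n + 1) → ℝ) (hσ : ∀ i, σ i ≠ 0)
    (hA₀full : IsUnit (A₀ᵀ * A₀).det) (hA₁full : IsUnit (A₁ᵀ * A₁).det) :
    let Sig₀ : Matrix (Fin n) (Fin n) ℝ :=
      Matrix.diagonal fun i => σ (Fin.castSucc i) ^ 2
    let Sig₁ : Matrix (Fin (n + 1)) (Fin (n + 1)) ℝ :=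
      Matrix.diagonal fun i => σ i ^ 2
    let V₀₀ := (A₀ᵀ * A₀)⁻¹ * A₀ᵀ * Sig₀ * A₀ * (A₀ᵀ * A₀)⁻¹
    let V₁₁ := (A₁ᵀ * A₁)⁻¹ * A₁ᵀ * Sig₁ * A₁ * (A₁ᵀ * A₁)⁻¹
    let d : ℝ := (a * (A₀ᵀ * A₀)⁻¹ * aᵀ) 0 0
    let q : ℝ := 1 + d
    let W := (1 / q) • ((A₀ᵀ * A₀)⁻¹ * aᵀ * a * (A₀ᵀ * A₀)⁻¹)
    let D : Matrix (Fin n) (Fin n) ℝ :=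
      Sig₀ - σ (Fin.last n) ^ 2 • (1 : Matrix (Fin n) (Fin n) ℝ)
    let D₁₁ := A₀ᵀ * D * A₀
    let W₁₁ := (A₀ᵀ * A₀)⁻¹ * D₁₁ * (A₀ᵀ * A₀)⁻¹ - (A₁ᵀ * A₁)⁻¹ * D₁₁ * (A₁ᵀ * A₁)⁻¹
    V₁₁ = V₀₀ - σ (Fin.last n) ^ 2 • W - W₁₁ := by
  intro Sig₀ Sig₁ V₀₀ V₁₁ d q W D D₁₁ W₁₁
  have hM : A₁ᵀ * A₁ = A₀ᵀ * A₀ + aᵀ * a := by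
    ext i j
    simp [Matrix.mul_apply, Fin.sum_univ_castSucc, hA₁cast, hA₁last]
  have hS₁ : A₁ᵀ * Sig₁ * A₁ = D₁₁ + σ (Fin.last n) ^ 2 • (A₁ᵀ * A₁) := by
    have h : A₁ᵀ * Sig₁ * A₁ = A₀ᵀ * Sig₀ * A₀ + σ (Fin.last n) ^ 2 • (aᵀ * a) := by
      ext i j
      rw [Matrix.mul_apply, Matrix.add_apply, Matrix.mul_apply, Matrix.smul_apply]
      simp only [Sig₁, Sig₀, Matrix.mul_diagonal, Fin.sum_univ_castSucc,
        Matrix.transpose_apply, hA₁cast, hA₁last]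
      simp only [Matrix.mul_apply, Matrix.transpose_apply, Fin.sum_univ_one, smul_eq_mul]
      ring
    rw [h, hM]
    simp only [D₁₁, D, Matrix.mul_sub, Matrix.sub_mul, Matrix.mul_smul, Matrix.smul_mul,
      Matrix.mul_one, smul_add]
    abel
  have hS₀ : A₀ᵀ * Sig₀ * A₀ = D₁₁ + σ (Fin.last n) ^ 2 • (A₀ᵀ * A₀) := by
    simp [D₁₁, D, Matrix.mul_sub, Matrix.sub_mul]
  have hV₀₀ : V₀₀ = (A₀ᵀ * A₀)⁻¹ * D₁₁ * (A₀ᵀ * A₀)⁻¹ + σ (Fin.last n) ^ 2 • (A₀ᵀ * A₀)⁻¹ := by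
    rw [← inv_mul_add_smul_self_mul_inv hA₀full, ← hS₀]
    simp only [V₀₀, Matrix.mul_assoc]
  have hV₁₁ : V₁₁ = (A₁ᵀ * A₁)⁻¹ * D₁₁ * (A₁ᵀ * A₁)⁻¹ + σ (Fin.last n) ^ 2 • (A₁ᵀ * A₁)⁻¹ := by
    rw [← inv_mul_add_smul_self_mul_inv hA₁full, ← hS₁]
    simp only [V₁₁, Matrix.mul_assoc]
  have hinv : (A₁ᵀ * A₁)⁻¹ = (A₀ᵀ * A₀)⁻¹ - W := by
    rw [hM] at hA₁full ⊢
    exact inv_add_mul_row hA₀full hA₁full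
  have hsmul : σ (Fin.last n) ^ 2 • (A₁ᵀ * A₁)⁻¹ =
      σ (Fin.last n) ^ 2 • (A₀ᵀ * A₀)⁻¹ - σ (Fin.last n) ^ 2 • W := by
    rw [hinv, smul_sub]
  rw [hV₀₀, hV₁₁, hsmul]
  simp only [W₁₁]
  abel
end

section
/- If D = s²·Iₙ for some real s (i.e., σᵢ² = σ_{n+1}² + s² for all i = 1,…,n), then W₁₁ = s²·(2 − d/(1+d))·W; consequently W₁₁ is positive semidefinite. -/
open Matrix

namespace Matrix

theorem transpose_mul_self_of_append_row {R : Type*} [CommRing R] {n k : ℕ}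
    {A₀ : Matrix (Fin n) (Fin k) R} {a : Matrix (Fin 1) (Fin k) R}
    {A₁ : Matrix (Fin (n + 1)) (Fin k) R}
    (hcast : ∀ (i : Fin n) (j : Fin k), A₁ (Fin.castSucc i) j = A₀ i j)
    (hlast : ∀ j : Fin k, A₁ (Fin.last n) j = a 0 j) :
    A₁ᵀ * A₁ = A₀ᵀ * A₀ + aᵀ * a := by
  ext i j
  simp [mul_apply, Fin.sum_univ_castSucc, hcast, hlast]

theorem eq_smul_one_of_unique {R m : Type*} [CommRing R] [Unique m] [DecidableEq m]
    (B : Matrix m m R) : B = B default default • (1 : Matrix m m R) := by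
  ext i j
  simp [Subsingleton.elim i default, Subsingleton.elim j default]

theorem row_sandwich {R k : Type*} [CommRing R] [Fintype k]
    (a : Matrix (Fin 1) k R) (P : Matrix k k R) :
    aᵀ * a * P * (aᵀ * a) = (a * P * aᵀ) 0 0 • (aᵀ * a) := by
  calc aᵀ * a * P * (aᵀ * a) = aᵀ * (a * P * aᵀ) * a := by simp only [Matrix.mul_assoc]
    _ = (a * P * aᵀ) 0 0 • (aᵀ * a) := by
      rw [eq_smul_one_of_unique (a * P * aᵀ)]
      simp

variable {R k : Type*} [CommRing R] [Fintype k] [DecidableEq k]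

/-- The Sherman–Morrison formula, for an update `M` satisfying `M * P * M = d • M`. -/
theorem inv_add_of_sandwich {G P M : Matrix k k R} {d r : R} (hGP : G * P = 1)
    (hM : M * P * M = d • M) (hr : r * (1 + d) = 1) :
    (G + M)⁻¹ = P - r • (P * M * P) := by
  apply inv_eq_right_inv
  have hGW : G * (P * M * P) = M * P := by
    rw [← Matrix.mul_assoc, ← Matrix.mul_assoc, hGP, Matrix.one_mul]
  have hMW : M * (P * M * P) = d • (M * P) := by
    rw [← Matrix.mul_assoc, ← Matrix.mul_assoc, hM, Matrix.smul_mul]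
  rw [Matrix.add_mul, Matrix.mul_sub, Matrix.mul_sub, Matrix.mul_smul, Matrix.mul_smul,
    hGP, hGW, hMW]
  have hsum : r • (M * P) + r • d • (M * P) = M * P := by
    rw [smul_smul, ← add_smul, ← mul_one_add, hr, one_smul]
  rw [sub_add_sub_comm, hsum, add_sub_cancel_right]

theorem sandwich_sub_sandwich {G P M : Matrix k k R} {d r : R} (hGP : G * P = 1)
    (hPG : P * G = 1) (hM : M * P * M = d • M) :
    P * G * P - (P - r • (P * M * P)) * G * (P - r • (P * M * P)) =
      (2 - r * d) • r • (P * M * P) := by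
  have hPGW : P * G * (P * M * P) = P * M * P := by rw [hPG, Matrix.one_mul]
  have hWGP : P * M * P * G * P = P * M * P := by
    rw [Matrix.mul_assoc _ G P, hGP, Matrix.mul_one]
  have hWGW : P * M * P * G * (P * M * P) = d • (P * M * P) := by
    calc P * M * P * G * (P * M * P) = P * (M * (P * G) * P * M) * P := by
          simp only [Matrix.mul_assoc]
      _ = d • (P * M * P) := by rw [hPG, Matrix.mul_one, hM]; simp
  simp only [Matrix.sub_mul, Matrix.mul_sub, Matrix.smul_mul, Matrix.mul_smul, hPGW, hWGP, hWGW]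
  module

end Matrix

/-- Theorem 2.2: if `D = s² Iₙ` then
`W₁₁ = s² (2 − d/(1+d)) W`, hence `W₁₁` is positive semidefinite. -/
theorem W11_of_homoscedastic_head
    (n k : ℕ) (hn : 1 ≤ n) (hk : 1 ≤ k)
    (A₀ : Matrix (Fin n) (Fin k) ℝ) (a : Matrix (Fin 1) (Fin k) ℝ)
    (A₁ : Matrix (Fin (n + 1)) (Fin k) ℝ)
    (hA₁cast : ∀ (i : Fin n) (j : Fin k), A₁ (Fin.castSucc i) j = A₀ i j)
    (hA₁last : ∀ j : Fin k, A₁ (Fin.last n) j = a 0 j)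
    (σ : Fin (n + 1) → ℝ) (s : ℝ)
    (hD : ∀ i : Fin n, σ (Fin.castSucc i) ^ 2 = σ (Fin.last n) ^ 2 + s ^ 2)
    (hA₀full : IsUnit (A₀ᵀ * A₀).det) (hA₁full : IsUnit (A₁ᵀ * A₁).det) :
    let Sig₀ : Matrix (Fin n) (Fin n) ℝ :=
      Matrix.diagonal fun i => σ (Fin.castSucc i) ^ 2
    let d : ℝ := (a * (A₀ᵀ * A₀)⁻¹ * aᵀ) 0 0
    let q : ℝ := 1 + d
    let W := (1 / q) • ((A₀ᵀ * A₀)⁻¹ * aᵀ * a * (A₀ᵀ * A₀)⁻¹)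
    let D : Matrix (Fin n) (Fin n) ℝ :=
      Sig₀ - σ (Fin.last n) ^ 2 • (1 : Matrix (Fin n) (Fin n) ℝ)
    let D₁₁ := A₀ᵀ * D * A₀
    let W₁₁ := (A₀ᵀ * A₀)⁻¹ * D₁₁ * (A₀ᵀ * A₀)⁻¹ - (A₁ᵀ * A₁)⁻¹ * D₁₁ * (A₁ᵀ * A₁)⁻¹
    W₁₁ = (s ^ 2 * (2 - d / (1 + d))) • W ∧ W₁₁.PosSemidef := by
  intro Sig₀ d q W D D₁₁ W₁₁
  have hPpsd : (A₀ᵀ * A₀)⁻¹.PosSemidef := by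
    simpa using (posSemidef_conjTranspose_mul_self A₀).inv
  have hd : 0 ≤ d := by
    simpa using (hPpsd.mul_mul_conjTranspose_same a).diag_nonneg (i := 0)
  have hq : 1 / q * (1 + d) = 1 := one_div_mul_cancel (by positivity)
  have hDs : D = s ^ 2 • (1 : Matrix (Fin n) (Fin n) ℝ) := by
    simp only [D, Sig₀, hD, smul_one_eq_diagonal, diagonal_sub]
    simp
  have hD₁₁ : D₁₁ = s ^ 2 • (A₀ᵀ * A₀) := by simp [D₁₁, hDs]
  have hGP := mul_nonsing_inv _ hA₀full
  have hM := row_sandwich a (A₀ᵀ * A₀)⁻¹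
  have hW : W = (1 / q) • ((A₀ᵀ * A₀)⁻¹ * (aᵀ * a) * (A₀ᵀ * A₀)⁻¹) := by
    simp only [W, Matrix.mul_assoc]
  have hW₁₁ : W₁₁ = (s ^ 2 * (2 - d / (1 + d))) • W := by
    have h := sandwich_sub_sandwich (r := 1 / q) hGP (nonsing_inv_mul _ hA₀full) hM
    rw [← inv_add_of_sandwich hGP hM hq,
      ← transpose_mul_self_of_append_row hA₁cast hA₁last, ← hW] at h
    have hdq : d / (1 + d) = 1 / q * d := by rw [one_div, div_eq_inv_mul]
    rw [hdq, mul_smul, ← h]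
    simp only [W₁₁, hD₁₁, Matrix.mul_smul, Matrix.smul_mul, smul_sub]
  refine ⟨hW₁₁, ?_⟩
  have hWpsd : W.PosSemidef := by
    rw [hW]
    refine PosSemidef.smul ?_ (by positivity)
    have h := (posSemidef_conjTranspose_mul_self a).mul_mul_conjTranspose_same (A₀ᵀ * A₀)⁻¹
    rwa [hPpsd.isHermitian.eq, conjTranspose_eq_transpose_of_trivial] at h
  have hfrac : d / (1 + d) ≤ 1 := div_le_one_of_le₀ (by linarith) (by linarith)
  rw [hW₁₁]
  exact hWpsd.smul (mul_nonneg (sq_nonneg s) (by linarith))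
end

section
/- If σᵢ² = σ² for i = 1,…,n and 0 < σ_{n+1}² < σ², then every diagonal entry of V₁₁ is less than or equal to the corresponding diagonal entry of V₀₀ (the variance reduction property holds for every component of the OLS estimator). -/
open Matrix

/-- If `M` and `N = M + P` are invertible, then `s M⁻¹ - N⁻¹ (s M + t P) N⁻¹` is the congruence by
`N⁻¹` of `(2 s - t) P + s P M⁻¹ P`. -/
lemma smul_inv_sub_inv_mul_mul_inv {k : Type*} [Fintype k] [DecidableEq k]
    {M P N : Matrix k k ℝ} (hN : N = M + P) (hMu : IsUnit M.det) (hNu : IsUnit N.det) (s t : ℝ) :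
    s • M⁻¹ - N⁻¹ * (s • M + t • P) * N⁻¹ =
      (2 * s - t) • (N⁻¹ * P * N⁻¹) + s • (N⁻¹ * (P * M⁻¹ * P) * N⁻¹) := by
  have hNMN : N * M⁻¹ * N = M + (2 : ℝ) • P + P * M⁻¹ * P := by
    rw [hN, add_mul, mul_nonsing_inv _ hMu, add_mul, one_mul, mul_add,
      nonsing_inv_mul_cancel_right _ _ hMu, two_smul]
    abel
  have hM : M⁻¹ = N⁻¹ * (N * M⁻¹ * N) * N⁻¹ := by
    rw [Matrix.mul_assoc N, nonsing_inv_mul_cancel_left _ _ hNu,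
      mul_nonsing_inv_cancel_right _ _ hNu]
  conv_lhs => rw [hM, hNMN]
  simp only [Matrix.mul_add, Matrix.add_mul, Matrix.mul_smul, Matrix.smul_mul]
  module

/-- The congruence of a Gram matrix by a symmetric matrix has a nonnegative diagonal. -/
lemma diag_mul_gram_mul_nonneg {m k : Type*} [Fintype m] [Fintype k]
    {B : Matrix k k ℝ} (hB : Bᵀ = B) (C : Matrix m k ℝ) (i : k) :
    0 ≤ (B * (Cᵀ * C) * B) i i := by
  have h : B * (Cᵀ * C) * B = (C * B)ᵀ * (C * B) := by
    rw [transpose_mul, hB]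
    simp only [Matrix.mul_assoc]
  rw [h, mul_apply]
  exact Finset.sum_nonneg fun j _ => mul_self_nonneg _

/-- Corollary 2.3: if the first `n` observations share the variance `s`
and the `(n+1)`-st observation has a smaller positive variance, then every diagonal entry
of `V₁₁` is at most the corresponding diagonal entry of `V₀₀` (variance reduction). -/
theorem vrp_of_equal_head_variances
    (n k : ℕ) (hn : 1 ≤ n) (hk : 1 ≤ k)
    (A₀ : Matrix (Fin n) (Fin k) ℝ) (a : Matrix (Fin 1) (Fin k) ℝ)
    (A₁ : Matrix (Fin (n + 1)) (Fin k) ℝ)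
    (hA₁cast : ∀ (i : Fin n) (j : Fin k), A₁ (Fin.castSucc i) j = A₀ i j)
    (hA₁last : ∀ j : Fin k, A₁ (Fin.last n) j = a 0 j)
    (σ : Fin (n + 1) → ℝ) (s : ℝ)
    (hhead : ∀ i : Fin n, σ (Fin.castSucc i) ^ 2 = s)
    (hlastpos : 0 < σ (Fin.last n) ^ 2)
    (hlastlt : σ (Fin.last n) ^ 2 < s)
    (hA₀full : IsUnit (A₀ᵀ * A₀).det) (hA₁full : IsUnit (A₁ᵀ * A₁).det) :
    let Sig₀ : Matrix (Fin n) (Fin n) ℝ :=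
      Matrix.diagonal fun i => σ (Fin.castSucc i) ^ 2
    let Sig₁ : Matrix (Fin (n + 1)) (Fin (n + 1)) ℝ :=
      Matrix.diagonal fun i => σ i ^ 2
    let V₀₀ := (A₀ᵀ * A₀)⁻¹ * A₀ᵀ * Sig₀ * A₀ * (A₀ᵀ * A₀)⁻¹
    let V₁₁ := (A₁ᵀ * A₁)⁻¹ * A₁ᵀ * Sig₁ * A₁ * (A₁ᵀ * A₁)⁻¹
    ∀ i : Fin k, V₁₁ i i ≤ V₀₀ i i := by
  intro Sig₀ Sig₁ V₀₀ V₁₁ i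
  set M := A₀ᵀ * A₀ with hM
  set N := A₁ᵀ * A₁ with hN
  set t := σ (Fin.last n) ^ 2 with ht
  have hMT : M⁻¹ᵀ = M⁻¹ := by
    rw [transpose_nonsing_inv, hM, transpose_mul, transpose_transpose]
  have hNT : N⁻¹ᵀ = N⁻¹ := by
    rw [transpose_nonsing_inv, hN, transpose_mul, transpose_transpose]
  have hadd : N = M + aᵀ * a := by
    ext p q
    simp [hN, hM, mul_apply, Fin.sum_univ_castSucc, hA₁cast, hA₁last]
  have hmid : A₁ᵀ * Sig₁ * A₁ = s • M + t • (aᵀ * a) := by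
    ext p q
    rw [mul_apply]
    simp only [Sig₁, mul_diagonal, transpose_apply, Fin.sum_univ_castSucc, hA₁cast, hA₁last, hhead]
    simp only [hM, mul_apply, transpose_apply, Matrix.add_apply, Matrix.smul_apply, smul_eq_mul,
      Finset.mul_sum, Finset.univ_unique, Finset.sum_singleton, Fin.default_eq_zero, ← ht]
    congr 1
    · exact Finset.sum_congr rfl fun _ _ => by ring
    · ring
  have hV₀ : V₀₀ = s • M⁻¹ := by
    have hSig : Sig₀ = s • (1 : Matrix (Fin n) (Fin n) ℝ) := by
      simp only [Sig₀, hhead, smul_one_eq_diagonal]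
    simp only [V₀₀, hSig, Matrix.mul_smul, Matrix.smul_mul, Matrix.mul_one]
    rw [Matrix.mul_assoc M⁻¹, ← hM, nonsing_inv_mul _ hA₀full, Matrix.one_mul]
  have hV₁ : V₁₁ = N⁻¹ * (s • M + t • (aᵀ * a)) * N⁻¹ := by
    rw [← hmid]
    simp only [V₁₁, ← hN, Matrix.mul_assoc]
  have hgram : aᵀ * a * M⁻¹ * (aᵀ * a) = (A₀ * M⁻¹ * (aᵀ * a))ᵀ * (A₀ * M⁻¹ * (aᵀ * a)) := by
    have h : M⁻¹ = M⁻¹ * (A₀ᵀ * A₀) * M⁻¹ := by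
      rw [← hM, nonsing_inv_mul _ hA₀full, Matrix.one_mul]
    conv_lhs => rw [h]
    simp only [transpose_mul, transpose_transpose, hMT, Matrix.mul_assoc]
  have hdiff := Matrix.ext_iff.mpr
    (smul_inv_sub_inv_mul_mul_inv hadd hA₀full hA₁full s t) i i
  rw [← hV₀, ← hV₁, hgram] at hdiff
  simp only [Matrix.sub_apply, Matrix.add_apply, Matrix.smul_apply, smul_eq_mul] at hdiff
  have h₁ := mul_nonneg (by linarith : 0 ≤ 2 * s - t) (diag_mul_gram_mul_nonneg hNT a i)
  have h₂ := mul_nonneg (by linarith : 0 ≤ s)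
    (diag_mul_gram_mul_nonneg hNT (A₀ * M⁻¹ * (aᵀ * a)) i)
  linarith
end

section
/- Fix i ∈ {1,…,k}. The diagonal entry W₁₁(i,i) is non-negative for every choice of variances with σ₁² ≥ σ₂² ≥ ⋯ ≥ σ_{n+1}² ≥ 0 if and only if for every m = 1,…,n one has ∑_{j=1}^m ( ((A₀ᵀA₀)⁻¹A₀ᵀ)(i,j)² − ((A₁ᵀA₁)⁻¹A₀ᵀ…)(i,j)² ) ≥ 0, where the second term is ( ∑_{l=1}^k (A₁ᵀA₁)⁻¹(i,l)·A₀(j,l) )² and the first term is ( ∑_{l=1}^k (A₀ᵀA₀)⁻¹(i,l)·A₀(j,l) )². -/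
open Matrix

/-- Telescoping of the consecutive differences of `s` from index `j` to the last index. -/
theorem Fin.sum_ite_le_castSucc_sub_succ {n : ℕ} (s : Fin (n + 1) → ℝ) (j : Fin n) :
    ∑ m : Fin n, (if j ≤ m then s m.castSucc - s m.succ else 0) =
      s j.castSucc - s (Fin.last n) := by
  induction n with
  | zero => exact j.elim0
  | succ n ih =>
    rw [Fin.sum_univ_castSucc]
    induction j using Fin.lastCases with
    | last => simp [Fin.le_iff_val_le_val, Nat.not_le.mpr]
    | cast j =>
      have h := ih (fun p => s p.castSucc) j
      simp only [Fin.castSucc_le_castSucc_iff, Fin.succ_castSucc, Fin.le_last, if_true,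
        Fin.succ_last] at h ⊢
      rw [h]
      ring

/-- Abel summation over `Fin n`. -/
theorem Fin.sum_mul_castSucc_sub_last {n : ℕ} (c : Fin n → ℝ) (s : Fin (n + 1) → ℝ) :
    ∑ j : Fin n, c j * (s j.castSucc - s (Fin.last n)) =
      ∑ m : Fin n, (s m.castSucc - s m.succ) * ∑ j ∈ Finset.Iic m, c j := by
  simp_rw [← Fin.sum_ite_le_castSucc_sub_succ s, Finset.mul_sum]
  rw [Finset.sum_comm]
  refine Finset.sum_congr rfl fun m _ => ?_
  have h : Finset.Iic m = Finset.univ.filter (fun j => j ≤ m) := by ext; simp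
  rw [h, Finset.sum_filter]
  refine Finset.sum_congr rfl fun j _ => ?_
  split_ifs <;> ring

/-- A weighted sum is nonnegative for all non-increasing squared weights iff all partial sums of
the coefficients are nonnegative. -/
theorem Fin.forall_sum_mul_sq_sub_nonneg_iff {n : ℕ} (c : Fin n → ℝ) :
    (∀ σ : Fin (n + 1) → ℝ, (∀ p q : Fin (n + 1), p ≤ q → σ q ^ 2 ≤ σ p ^ 2) →
        0 ≤ ∑ j : Fin n, c j * (σ j.castSucc ^ 2 - σ (Fin.last n) ^ 2)) ↔
      ∀ m : Fin n, 0 ≤ ∑ j ∈ Finset.Iic m, c j := by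
  constructor
  · intro h m
    have hm := h (fun p => if p ≤ m.castSucc then 1 else 0) (by
      intro p q hpq
      by_cases hq : q ≤ m.castSucc
      · simp [hq, hpq.trans hq]
      · simp only [hq, if_false, ne_eq, OfNat.ofNat_ne_zero, not_false_eq_true, zero_pow]
        split_ifs <;> norm_num)
    have hf : Finset.Iic m = Finset.univ.filter (fun j => j ≤ m) := by ext; simp
    have hl : ¬ Fin.last n ≤ m.castSucc := not_le.mpr (Fin.castSucc_lt_last m)
    rw [hf, Finset.sum_filter]
    simpa [hl, Fin.castSucc_le_castSucc_iff] using hm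
  · intro h σ hσ
    rw [Fin.sum_mul_castSucc_sub_last c (fun p => σ p ^ 2)]
    exact Finset.sum_nonneg fun m _ =>
      mul_nonneg (sub_nonneg.mpr (hσ _ _ m.castSucc_lt_succ.le)) (h m)

/-- Diagonal entries of `B * (Aᵀ * diagonal d * A) * B` for symmetric `B`. -/
theorem Matrix.IsSymm.mul_transpose_diagonal_mul_apply_self {ι κ : Type*} [Fintype ι]
    [DecidableEq ι] [Fintype κ] {B : Matrix κ κ ℝ} (hB : B.IsSymm) (A : Matrix ι κ ℝ)
    (d : ι → ℝ) (i : κ) :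
    (B * (Aᵀ * diagonal d * A) * B) i i = ∑ j, (∑ l, B i l * A j l) ^ 2 * d j := by
  have h : B * (Aᵀ * diagonal d * A) * B = (B * Aᵀ) * diagonal d * (B * Aᵀ)ᵀ := by
    rw [transpose_mul, transpose_transpose, hB.eq]
    simp only [Matrix.mul_assoc]
  rw [h, mul_apply]
  refine Finset.sum_congr rfl fun j _ => ?_
  rw [mul_diagonal, transpose_apply, mul_apply]
  simp only [transpose_apply]
  ring


/-- Proposition 2.4: characterization of the non-negativity
of the `i`-th diagonal entry of `W₁₁` for all non-increasing variance sequences. -/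
theorem W11_diag_nonneg_iff
    (n k : ℕ) (hn : 1 ≤ n) (hk : 1 ≤ k)
    (A₀ : Matrix (Fin n) (Fin k) ℝ) (a : Matrix (Fin 1) (Fin k) ℝ)
    (A₁ : Matrix (Fin (n + 1)) (Fin k) ℝ)
    (hA₁cast : ∀ (i : Fin n) (j : Fin k), A₁ (Fin.castSucc i) j = A₀ i j)
    (hA₁last : ∀ j : Fin k, A₁ (Fin.last n) j = a 0 j)
    (hA₀full : IsUnit (A₀ᵀ * A₀).det) (hA₁full : IsUnit (A₁ᵀ * A₁).det)
    (i : Fin k) :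
    (∀ σ : Fin (n + 1) → ℝ,
        (∀ p q : Fin (n + 1), p ≤ q → σ q ^ 2 ≤ σ p ^ 2) →
        0 ≤ ((A₀ᵀ * A₀)⁻¹ *
              (A₀ᵀ *
                (Matrix.diagonal (fun j : Fin n => σ (Fin.castSucc j) ^ 2) -
                  σ (Fin.last n) ^ 2 • (1 : Matrix (Fin n) (Fin n) ℝ)) * A₀) *
              (A₀ᵀ * A₀)⁻¹ -
            (A₁ᵀ * A₁)⁻¹ *
              (A₀ᵀ *
                (Matrix.diagonal (fun j : Fin n => σ (Fin.castSucc j) ^ 2) -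
                  σ (Fin.last n) ^ 2 • (1 : Matrix (Fin n) (Fin n) ℝ)) * A₀) *
              (A₁ᵀ * A₁)⁻¹) i i)
      ↔
    (∀ m : Fin n,
        0 ≤ ∑ j ∈ Finset.Iic m,
              ((∑ l : Fin k, (A₀ᵀ * A₀)⁻¹ i l * A₀ j l) ^ 2 -
               (∑ l : Fin k, (A₁ᵀ * A₁)⁻¹ i l * A₀ j l) ^ 2)) := by
  have hsymm : ∀ {r : ℕ} (A : Matrix (Fin r) (Fin k) ℝ), ((Aᵀ * A)⁻¹).IsSymm := fun A => by
    rw [IsSymm, transpose_nonsing_inv, transpose_mul, transpose_transpose]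
  rw [← Fin.forall_sum_mul_sq_sub_nonneg_iff]
  refine forall_congr' fun σ => imp_congr_right fun _ => ?_
  rw [smul_one_eq_diagonal, diagonal_sub, Matrix.sub_apply,
    (hsymm A₀).mul_transpose_diagonal_mul_apply_self,
    (hsymm A₁).mul_transpose_diagonal_mul_apply_self, ← Finset.sum_sub_distrib]
  simp only [sub_mul]
end

section
/- Fix i ∈ {1,…,k} and suppose the variances are non-increasing with all σⱼ nonzero: σ₁² ≥ σ₂² ≥ ⋯ ≥ σ_{n+1}² > 0. If for every m = 1,…,n one has ∑_{j=1}^m ( ( ∑_{l=1}^k (A₀ᵀA₀)⁻¹(i,l)·A₀(j,l) )² − ( ∑_{l=1}^k (A₁ᵀA₁)⁻¹(i,l)·A₀(j,l) )² ) ≥ 0, then V₁₁(i,i) ≤ V₀₀(i,i), i.e., the OLS estimator of the i-th component has the variance reduction property. -/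
open Matrix

/-- The weights with which ordinary least squares combines the observations: `(AᵀA)⁻¹Aᵀ`. -/
noncomputable def olsWeights {m κ : Type*} [Fintype m] [Fintype κ] [DecidableEq κ]
    (A : Matrix m κ ℝ) : Matrix κ m ℝ :=
  (Aᵀ * A)⁻¹ * Aᵀ

section OLS

variable {m κ : Type*} [Fintype m] [Fintype κ] [DecidableEq κ]

theorem olsWeights_apply (A : Matrix m κ ℝ) (i : κ) (j : m) :
    olsWeights A i j = ∑ l, (Aᵀ * A)⁻¹ i l * A j l := by
  simp [olsWeights, Matrix.mul_apply]

theorem olsWeights_transpose (A : Matrix m κ ℝ) :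
    (olsWeights A)ᵀ = A * (Aᵀ * A)⁻¹ := by
  simp [olsWeights, Matrix.transpose_mul, Matrix.transpose_nonsing_inv]

theorem olsWeights_mul_self {A : Matrix m κ ℝ} (hA : IsUnit (Aᵀ * A).det) :
    olsWeights A * A = 1 := by
  rw [olsWeights, Matrix.mul_assoc, Matrix.nonsing_inv_mul _ hA]

theorem ols_covariance_apply_self [DecidableEq m] (A : Matrix m κ ℝ) (s : m → ℝ) (i : κ) :
    ((Aᵀ * A)⁻¹ * Aᵀ * Matrix.diagonal s * A * (Aᵀ * A)⁻¹) i i =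
      ∑ j, s j * olsWeights A i j ^ 2 := by
  rw [Matrix.mul_assoc _ A, ← olsWeights_transpose, ← olsWeights, Matrix.mul_apply]
  refine Finset.sum_congr rfl fun j _ => ?_
  rw [Matrix.mul_diagonal, Matrix.transpose_apply]
  ring

/-- Among all linear unbiased estimators of the `i`-th component, the ordinary least squares
weights have the smallest Euclidean norm. -/
theorem sum_sq_olsWeights_le {A : Matrix m κ ℝ} (hA : IsUnit (Aᵀ * A).det) (i : κ)
    {u : m → ℝ} (hu : u ᵥ* A = Pi.single i 1) :
    ∑ j, olsWeights A i j ^ 2 ≤ ∑ j, u j ^ 2 := by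
  have hw : olsWeights A i ᵥ* A = Pi.single i 1 := by
    ext l
    have := congrFun (congrFun (olsWeights_mul_self hA) i) l
    rw [Matrix.mul_apply_eq_vecMul] at this
    rw [this, Matrix.one_apply, Pi.single_apply]
    simp only [eq_comm]
  have hcol : olsWeights A i = A *ᵥ (Aᵀ * A)⁻¹.col i := by
    ext j
    exact congrFun (congrFun (olsWeights_transpose A) j) i
  have horth : (u - olsWeights A i) ⬝ᵥ olsWeights A i = 0 := by
    conv_lhs => rw [hcol, Matrix.dotProduct_mulVec, ← hcol]
    rw [Matrix.sub_vecMul, hu, hw, sub_self, zero_dotProduct]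
  have hsum : ∑ j, u j ^ 2 = ∑ j, olsWeights A i j ^ 2 + ∑ j, (u j - olsWeights A i j) ^ 2
      + 2 * ((u - olsWeights A i) ⬝ᵥ olsWeights A i) := by
    rw [dotProduct, Finset.mul_sum, ← Finset.sum_add_distrib, ← Finset.sum_add_distrib]
    refine Finset.sum_congr rfl fun j _ => ?_
    rw [Pi.sub_apply]
    ring
  have : 0 ≤ ∑ j, (u j - olsWeights A i j) ^ 2 := Finset.sum_nonneg fun j _ => sq_nonneg _
  linarith

end OLS

/-- Abel's inequality for an antitone weight and nonnegative proper partial sums. -/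
theorem last_mul_sum_le_sum_mul_of_antitone {n : ℕ} {s d : Fin (n + 1) → ℝ} (hs : Antitone s)
    (hd : ∀ m : Fin n, 0 ≤ ∑ j ∈ Finset.Iic m, d j.castSucc) :
    s (Fin.last n) * ∑ j, d j ≤ ∑ j, s j * d j := by
  induction n with
  | zero => simp
  | succ n ih =>
    have hinit := ih (s := fun j => s j.castSucc) (d := fun j => d j.castSucc)
      (fun p q hpq => hs (Fin.castSucc_le_castSucc_iff.mpr hpq)) fun m => by
        have := hd m.castSucc
        rwa [← Fin.map_castSuccEmb_Iic, Finset.sum_map] at this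
    have htotal : 0 ≤ ∑ j : Fin (n + 1), d j.castSucc := by
      have := hd (Fin.last n)
      rwa [← Fin.top_eq_last, Finset.Iic_top] at this
    have hlast := mul_le_mul_of_nonneg_right (hs (Fin.le_last (Fin.last n).castSucc)) htotal
    rw [Fin.sum_univ_castSucc, Fin.sum_univ_castSucc (fun j => s j * d j), mul_add]
    linarith

/-- Theorem 2.5: if the partial-sum condition holds for the `i`-th
row, then the OLS estimator of the `i`-th component has the variance reduction
property: `V₁₁(i,i) ≤ V₀₀(i,i)`. -/
theorem vrp_component_of_partial_sums
    (n k : ℕ) (hn : 1 ≤ n) (hk : 1 ≤ k)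
    (A₀ : Matrix (Fin n) (Fin k) ℝ) (a : Matrix (Fin 1) (Fin k) ℝ)
    (A₁ : Matrix (Fin (n + 1)) (Fin k) ℝ)
    (hA₁cast : ∀ (i : Fin n) (j : Fin k), A₁ (Fin.castSucc i) j = A₀ i j)
    (hA₁last : ∀ j : Fin k, A₁ (Fin.last n) j = a 0 j)
    (σ : Fin (n + 1) → ℝ)
    (hσmono : ∀ p q : Fin (n + 1), p ≤ q → σ q ^ 2 ≤ σ p ^ 2)
    (hσlast : 0 < σ (Fin.last n) ^ 2)
    (hA₀full : IsUnit (A₀ᵀ * A₀).det) (hA₁full : IsUnit (A₁ᵀ * A₁).det)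
    (i : Fin k)
    (hcond : ∀ m : Fin n,
        0 ≤ ∑ j ∈ Finset.Iic m,
              ((∑ l : Fin k, (A₀ᵀ * A₀)⁻¹ i l * A₀ j l) ^ 2 -
               (∑ l : Fin k, (A₁ᵀ * A₁)⁻¹ i l * A₀ j l) ^ 2)) :
    let Sig₀ : Matrix (Fin n) (Fin n) ℝ :=
      Matrix.diagonal fun j => σ (Fin.castSucc j) ^ 2
    let Sig₁ : Matrix (Fin (n + 1)) (Fin (n + 1)) ℝ :=
      Matrix.diagonal fun j => σ j ^ 2
    let V₀₀ := (A₀ᵀ * A₀)⁻¹ * A₀ᵀ * Sig₀ * A₀ * (A₀ᵀ * A₀)⁻¹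
    let V₁₁ := (A₁ᵀ * A₁)⁻¹ * A₁ᵀ * Sig₁ * A₁ * (A₁ᵀ * A₁)⁻¹
    V₁₁ i i ≤ V₀₀ i i := by
  intro Sig₀ Sig₁ V₀₀ V₁₁
  set u : Fin (n + 1) → ℝ := Fin.snoc (olsWeights A₀ i) 0 with hu
  have hu_cast (j : Fin n) : u j.castSucc = olsWeights A₀ i j := by simp [hu]
  have hu_last : u (Fin.last n) = 0 := by simp [hu]
  have hunbiased : u ᵥ* A₁ = Pi.single i 1 := by
    ext l
    have := congrFun (congrFun (olsWeights_mul_self hA₀full) i) l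
    rw [Matrix.mul_apply, Matrix.one_apply] at this
    simp only [Matrix.vecMul, dotProduct, Fin.sum_univ_castSucc, hu_cast, hu_last, hA₁cast,
      zero_mul, add_zero, this, Pi.single_apply, eq_comm]
  have hV₀₀ : V₀₀ i i = ∑ j, σ j ^ 2 * u j ^ 2 := by
    simp only [V₀₀, Sig₀, ols_covariance_apply_self, Fin.sum_univ_castSucc, hu_cast, hu_last]
    ring
  have hV₁₁ : V₁₁ i i = ∑ j, σ j ^ 2 * olsWeights A₁ i j ^ 2 :=
    ols_covariance_apply_self A₁ _ i
  have habel := last_mul_sum_le_sum_mul_of_antitone (s := fun j => σ j ^ 2)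
    (d := fun j => u j ^ 2 - olsWeights A₁ i j ^ 2) (fun p q hpq => hσmono p q hpq) fun m => by
      simpa only [hu_cast, olsWeights_apply, hA₁cast] using hcond m
  simp only [mul_sub, Finset.sum_sub_distrib] at habel
  have hnorm := mul_le_mul_of_nonneg_left (sum_sq_olsWeights_le hA₁full i hunbiased) hσlast.le
  rw [hV₀₀, hV₁₁]
  linarith
end

section
/- If 0 ≤ h₁ < h₂ < ⋯ < h_{n+1} (non-negative, strictly increasing design points) and σ₁² ≥ σ₂² ≥ ⋯ ≥ σ_{n+1}² > 0 (non-increasing variances), then V₁₁(i,i) ≤ V₀₀(i,i) for i = 1, 2; that is, the OLS estimators of both the intercept and the slope have the variance reduction property. -/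
open Matrix

open Finset in
/-- Abel summation: nonnegative partial sums against nonincreasing nonnegative weights. -/
theorem sum_mul_nonneg_of_partial_sums_nonneg {f s : ℕ → ℝ} {m : ℕ}
    (hf : ∀ k ≤ m, 0 ≤ ∑ i ∈ range k, f i)
    (hs : ∀ i, i + 1 < m → s (i + 1) ≤ s i) (hs0 : ∀ i < m, 0 ≤ s i) :
    0 ≤ ∑ i ∈ range m, f i * s i := by
  have key : ∀ k, k < m →
      s k * ∑ i ∈ range (k + 1), f i ≤ ∑ i ∈ range (k + 1), f i * s i := by
    intro k
    induction k with
    | zero => intro _; simp [mul_comm]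
    | succ k ih =>
      intro hk
      have h1 := ih (by omega)
      rw [sum_range_succ, sum_range_succ (fun i => f i * s i)]
      have h2 := mul_le_mul_of_nonneg_right (hs k hk) (hf (k + 1) (by omega))
      linarith
  rcases m with _ | m
  · simp
  · exact (mul_nonneg (hs0 m (by omega)) (hf (m + 1) le_rfl)).trans (key m (by omega))

/-- The scalar inequality behind `partial_sum_sq_update_le`. -/
theorem update_sq_le_of_moment_bounds {P Q K U S α δ e : ℝ} (hP : 0 < P) (hQ : 0 ≤ Q)
    (hK : 0 < K) (hS : 0 ≤ S) (hδ : 0 < δ) (he : 0 ≤ e) (heδ : e ≤ δ)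
    (hW : Q ≤ (U - K) * δ) (hSle : S ≤ P + (δ - α) * Q + (U - K) * α * δ)
    (hKα : K * α ≤ Q) (hαQ : α * Q ≤ P) (hcs : Q ^ 2 ≤ K * P) :
    (P + 2 * e * Q + e ^ 2 * K) * S ^ 2 ≤ P * (S + e * U * δ) ^ 2 := by
  obtain ⟨W, hWdef⟩ : ∃ W, W = (U - K) * δ - Q := ⟨_, rfl⟩
  have hW0 : 0 ≤ W := by linarith
  have hUδ : U * δ = K * δ + W + Q := by rw [hWdef]; ring
  have hS' : S ≤ P + δ * Q + α * W := by rw [hWdef]; linarith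
  obtain ⟨T, hT⟩ : ∃ T, T = P * (U * δ) - Q * S := ⟨_, rfl⟩
  have hTge : δ * (K * P - Q ^ 2) + W * (P - α * Q) ≤ T := by
    have := mul_le_mul_of_nonneg_left hS' hQ
    rw [hT, hUδ]; linarith
  have hT0 : 0 ≤ T := le_trans (add_nonneg (mul_nonneg hδ.le (by linarith))
    (mul_nonneg hW0 (by linarith))) hTge
  obtain ⟨G, hG⟩ : ∃ G, G = K * δ + W := ⟨_, rfl⟩
  have hG0 : 0 < G := by rw [hG]; positivity
  have hKT : (K * P - Q ^ 2) * G ≤ K * T := by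
    have h1 := mul_le_mul_of_nonneg_left hTge hK.le
    have h2 : W * (K * P - Q ^ 2) ≤ W * (K * (P - α * Q)) :=
      mul_le_mul_of_nonneg_left (by nlinarith [mul_le_mul_of_nonneg_right hKα hQ]) hW0
    rw [hG]; linarith
  have hfac : e * K * S ≤ (2 * P + 2 * e * Q) * G := by
    have h1 := mul_le_mul_of_nonneg_left hS' (mul_nonneg he hK.le)
    have h2 : e * W * (K * α) ≤ e * W * Q := mul_le_mul_of_nonneg_left hKα (mul_nonneg he hW0)
    have h3 : K * P * e ≤ K * P * δ := mul_le_mul_of_nonneg_left heδ (mul_nonneg hK.le hP.le)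
    have h4 : 0 ≤ e * K * δ * Q := by positivity
    have h5 : 0 ≤ K * P * δ := by positivity
    have h6 : 0 ≤ e * W * Q := by positivity
    have h7 : 0 ≤ P * W := by positivity
    rw [hG]; linarith
  have hdiff : 0 ≤ 2 * S * T + e * (P * (U * δ) ^ 2 - K * S ^ 2) := by
    have hPU : P * (U * δ) = T + Q * S := by rw [hT]; ring
    have hid : P * G * (2 * S * T + e * (P * (U * δ) ^ 2 - K * S ^ 2))
        = T * S * ((2 * P + 2 * e * Q) * G - e * K * S) + e * G * T ^ 2
          + e * S ^ 2 * (K * T - (K * P - Q ^ 2) * G) := by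
      have : P * (P * (U * δ) ^ 2) = (T + Q * S) ^ 2 := by rw [← hPU]; ring
      linear_combination e * G * this
    have hpos : 0 ≤ P * G * (2 * S * T + e * (P * (U * δ) ^ 2 - K * S ^ 2)) := by
      rw [hid]
      have h1 : 0 ≤ T * S * ((2 * P + 2 * e * Q) * G - e * K * S) :=
        mul_nonneg (mul_nonneg hT0 hS) (by linarith)
      have h2 : 0 ≤ e * S ^ 2 * (K * T - (K * P - Q ^ 2) * G) :=
        mul_nonneg (by positivity) (by linarith)
      have h3 : 0 ≤ e * G * T ^ 2 := by positivity
      linarith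
    exact nonneg_of_mul_nonneg_right hpos (by positivity)
  have hfin := mul_nonneg he hdiff
  rw [hT] at hfin
  linarith

open Finset in
/-- Partial sums of the squared (unnormalised) OLS weights after adding the row `(u n, v n)` to
the orthogonal design with rows `(u i, v i)`, `i < n`. -/
theorem partial_sum_sq_update_le {n k : ℕ} {u v : ℕ → ℝ} {δ e : ℝ} (hn : 2 ≤ n)
    (hu0 : 0 ≤ u 0) (hu : ∀ i, 0 < i → i ≤ n → 0 < u i)
    (hv0 : v 0 < 0) (hord : ∀ i j, i < j → j ≤ n → v i * u j < v j * u i)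
    (horth : ∑ i ∈ range n, u i * v i = 0)
    (hδ : 0 < δ) (hδn : v n = δ * u n) (he : 0 ≤ e) (heδ : e ≤ δ) (hk : k ≤ n) :
    (∑ i ∈ range k, (v i - e * u i) ^ 2) * (∑ i ∈ range n, v i ^ 2) ^ 2
      ≤ (∑ i ∈ range k, v i ^ 2) *
        ((∑ i ∈ range n, v i ^ 2) + e * (∑ i ∈ range n, u i ^ 2) * δ) ^ 2 := by
  have hunn : ∀ i, i ≤ n → 0 ≤ u i := fun i hi => by
    rcases Nat.eq_zero_or_pos i with rfl | h
    · exact hu0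
    · exact (hu i h hi).le
  have hUnn : 0 ≤ ∑ i ∈ range n, u i ^ 2 := sum_nonneg fun i _ => sq_nonneg _
  have hSnn : 0 ≤ ∑ i ∈ range n, v i ^ 2 := sum_nonneg fun i _ => sq_nonneg _
  rcases k with _ | k
  · simp
  rcases (hunn k (by omega)).eq_or_lt with h0 | hupos
  · obtain rfl : k = 0 := by
      by_contra hne
      exact absurd (hu k (by omega) (by omega)) (by simp [← h0])
    simp only [zero_add, sum_range_one, ← h0, mul_zero, sub_zero]
    refine mul_le_mul_of_nonneg_left (pow_le_pow_left₀ hSnn ?_ 2) (sq_nonneg _)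
    have : 0 ≤ e * (∑ i ∈ range n, u i ^ 2) * δ := by positivity
    linarith
  obtain ⟨α, hα⟩ : ∃ α, v k = -α * u k := ⟨-(v k / u k), by field_simp⟩
  have hlow : ∀ i ∈ range (k + 1), v i ≤ -α * u i := fun i hi => by
    rcases (Nat.lt_succ_iff.1 (mem_range.1 hi)).eq_or_lt with rfl | h
    · exact hα.le
    · have := hord i k h (by omega)
      rw [hα] at this
      nlinarith
  have hhigh : ∀ i ∈ Ico (k + 1) n, -α * u i ≤ v i ∧ v i ≤ δ * u i := fun i hi => by
    rw [mem_Ico] at hi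
    have h1 := hord k i (by omega) (by omega)
    have h2 := hord i n (by omega) le_rfl
    have h3 := hu n (by omega) le_rfl
    rw [hα] at h1
    rw [hδn] at h2
    constructor <;> nlinarith
  have hUsplit := sum_range_add_sum_Ico (fun i => u i ^ 2) hk
  have hSsplit := sum_range_add_sum_Ico (fun i => v i ^ 2) hk
  have hOsplit := sum_range_add_sum_Ico (fun i => u i * v i) hk
  rw [horth] at hOsplit
  have hIcoNn : ∀ i ∈ Ico (k + 1) n, 0 ≤ u i := fun i hi => hunn i (by rw [mem_Ico] at hi; omega)
  have hranNn : ∀ i ∈ range (k + 1), 0 ≤ u i := fun i hi =>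
    hunn i (by rw [mem_range] at hi; omega)
  have hWle : ∑ i ∈ Ico (k + 1) n, u i * v i ≤ δ * ∑ i ∈ Ico (k + 1) n, u i ^ 2 := by
    rw [mul_sum]
    exact sum_le_sum fun i hi => by nlinarith [hhigh i hi, hIcoNn i hi]
  have hRle : ∑ i ∈ Ico (k + 1) n, v i ^ 2 ≤
      (δ - α) * (∑ i ∈ Ico (k + 1) n, u i * v i) + α * δ * ∑ i ∈ Ico (k + 1) n, u i ^ 2 := by
    rw [mul_sum, mul_sum, ← sum_add_distrib]
    exact sum_le_sum fun i hi => by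
      obtain ⟨h1, h2⟩ := hhigh i hi
      nlinarith [mul_nonneg (sub_nonneg.2 h1) (sub_nonneg.2 h2)]
  have hKα : ∑ i ∈ range (k + 1), u i * v i ≤ -α * ∑ i ∈ range (k + 1), u i ^ 2 := by
    rw [mul_sum]
    exact sum_le_sum fun i hi => by nlinarith [hlow i hi, hranNn i hi]
  have hcs := sum_mul_sq_le_sq_mul_sq (range (k + 1)) u v
  have hKpos : 0 < ∑ i ∈ range (k + 1), u i ^ 2 :=
    sum_pos' (fun i _ => sq_nonneg _) ⟨k, by simp, by positivity⟩
  have hPpos : 0 < ∑ i ∈ range (k + 1), v i ^ 2 :=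
    sum_pos' (fun i _ => sq_nonneg _) ⟨0, by simp, sq_pos_of_neg hv0⟩
  have hQ : ∑ i ∈ range (k + 1), u i * v i ≤ 0 := by
    rcases le_total 0 α with h | h
    · nlinarith
    · have : 0 ≤ ∑ i ∈ Ico (k + 1) n, u i * v i := sum_nonneg fun i hi =>
        mul_nonneg (hIcoNn i hi) (by nlinarith [hhigh i hi, hIcoNn i hi])
      linarith
  have hαQ : 0 ≤ (∑ i ∈ range (k + 1), v i ^ 2) + α * ∑ i ∈ range (k + 1), u i * v i := by
    rcases le_total 0 α with h | h
    · rw [mul_sum, ← sum_add_distrib]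
      refine sum_nonneg fun i hi => ?_
      have h1 := hlow i hi
      have h2 := mul_nonneg h (hranNn i hi)
      nlinarith
    · nlinarith
  have hexp : ∑ i ∈ range (k + 1), (v i - e * u i) ^ 2 = (∑ i ∈ range (k + 1), v i ^ 2)
      + 2 * e * (-∑ i ∈ range (k + 1), u i * v i) + e ^ 2 * ∑ i ∈ range (k + 1), u i ^ 2 := by
    rw [← sum_neg_distrib, mul_sum, mul_sum, ← sum_add_distrib, ← sum_add_distrib]
    exact sum_congr rfl fun i _ => by ring
  have hIcoO : ∑ i ∈ Ico (k + 1) n, u i * v i = -∑ i ∈ range (k + 1), u i * v i := by linarith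
  have hIcoU : ∑ i ∈ Ico (k + 1) n, u i ^ 2
      = (∑ i ∈ range n, u i ^ 2) - ∑ i ∈ range (k + 1), u i ^ 2 := by linarith
  rw [hIcoO, hIcoU] at hWle hRle
  rw [hexp]
  exact update_sq_le_of_moment_bounds (α := α) hPpos (by linarith) hKpos hSnn hδ he heδ
    (by linarith) (by linarith) (by linarith) (by linarith) (by rw [neg_sq]; exact hcs)

open Finset in
/-- Adding the row `(u n, v n)` to an orthogonal design with rows `(u i, v i)`, `i < n`, does not
increase the variance of the OLS coefficient of `v`. -/
theorem variance_update_le {n : ℕ} {u v s : ℕ → ℝ} (hn : 2 ≤ n)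
    (hu0 : 0 ≤ u 0) (hu : ∀ i, 0 < i → i ≤ n → 0 < u i)
    (hv0 : v 0 < 0) (hord : ∀ i j, i < j → j ≤ n → v i * u j < v j * u i)
    (horth : ∑ i ∈ range n, u i * v i = 0)
    (hs : ∀ i, i + 1 < n + 1 → s (i + 1) ≤ s i) (hs0 : ∀ i < n + 1, 0 ≤ s i)
    {U S e S' : ℝ} (hU : U = ∑ i ∈ range n, u i ^ 2) (hS : S = ∑ i ∈ range n, v i ^ 2)
    (he : e = v n * u n / (U + u n ^ 2)) (hS' : S' = S + v n ^ 2 * U / (U + u n ^ 2)) :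
    ∑ i ∈ range (n + 1), ((v i - e * u i) / S') ^ 2 * s i
      ≤ ∑ i ∈ range n, (v i / S) ^ 2 * s i := by
  have hun := hu n (by omega) le_rfl
  have hUpos : 0 < U := by
    rw [hU]
    exact sum_pos' (fun i _ => sq_nonneg _)
      ⟨1, by simp; omega, pow_pos (hu 1 one_pos (by omega)) 2⟩
  have hSpos : 0 < S := by
    rw [hS]
    exact sum_pos' (fun i _ => sq_nonneg _) ⟨0, by simp; omega, sq_pos_of_neg hv0⟩
  have hvn : 0 < v n := by
    have h1 : ∑ i ∈ range n, u n * (u i * v i) < ∑ i ∈ range n, v n * u i ^ 2 := by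
      refine sum_lt_sum (fun i hi => ?_) ⟨1, by simp; omega, ?_⟩
      · have hin := mem_range.1 hi
        have := hord i n hin le_rfl
        have hui : 0 ≤ u i := by
          rcases Nat.eq_zero_or_pos i with rfl | h
          · exact hu0
          · exact (hu i h hin.le).le
        nlinarith
      · nlinarith [hord 1 n (by omega) le_rfl, hu 1 one_pos (by omega)]
    rw [← mul_sum, ← mul_sum, horth, mul_zero, ← hU] at h1
    exact pos_of_mul_pos_left h1 hUpos.le
  have hden : 0 < U + u n ^ 2 := by positivity
  have hepos : 0 ≤ e := by rw [he]; positivity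
  have hS'pos : 0 < S' := by rw [hS']; positivity
  have hSS' : S ≤ S' := by rw [hS']; have : 0 ≤ v n ^ 2 * U / (U + u n ^ 2) := by positivity
                           linarith
  have hS'δ : S' = S + e * U * (v n / u n) := by rw [hS', he]; field_simp
  have heδ : e ≤ v n / u n := by
    rw [he, div_le_div_iff₀ hden hun]
    nlinarith [mul_pos hvn hUpos]
  have hpart : ∀ k ≤ n, ∑ i ∈ range k, ((v i - e * u i) / S') ^ 2
      ≤ ∑ i ∈ range k, (v i / S) ^ 2 := fun k hk => by
    have := partial_sum_sq_update_le (δ := v n / u n) hn hu0 hu hv0 hord horth (by positivity)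
      (by field_simp) hepos heδ hk
    rw [← hU, ← hS, ← hS'δ] at this
    simp only [div_pow]
    rw [← sum_div, ← sum_div, div_le_div_iff₀ (by positivity) (by positivity)]
    exact this
  have hfull : ∑ i ∈ range (n + 1), (v i - e * u i) ^ 2 = S' := by
    have hexp : ∑ i ∈ range n, (v i - e * u i) ^ 2 = S + e ^ 2 * U := by
      have : ∑ i ∈ range n, (v i - e * u i) ^ 2 = (∑ i ∈ range n, v i ^ 2)
          - 2 * e * (∑ i ∈ range n, u i * v i) + e ^ 2 * ∑ i ∈ range n, u i ^ 2 := by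
        rw [mul_sum, mul_sum, ← sum_sub_distrib, ← sum_add_distrib]
        exact sum_congr rfl fun i _ => by ring
      rw [this, horth, hU, hS]; ring
    rw [sum_range_succ, hexp, hS', he]
    field_simp
    ring
  have hext : ∀ k ≤ n, ∀ g : ℕ → ℝ,
      ∑ i ∈ range k, (if i < n then (v i / S) ^ 2 else 0) * g i
        = ∑ i ∈ range k, (v i / S) ^ 2 * g i := fun k hk g =>
    sum_congr rfl fun i hi => by rw [if_pos ((mem_range.1 hi).trans_le hk)]
  have habel := sum_mul_nonneg_of_partial_sums_nonneg (m := n + 1) (s := s)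
    (f := fun i => (if i < n then (v i / S) ^ 2 else 0) - ((v i - e * u i) / S') ^ 2) ?_ hs hs0
  · simp only [sub_mul, sum_sub_distrib] at habel
    rw [sum_range_succ (fun i => (if i < n then (v i / S) ^ 2 else 0) * s i),
      hext n le_rfl] at habel
    simp only [lt_irrefl, if_false, zero_mul, add_zero] at habel
    linarith
  · intro k hk
    rw [sum_sub_distrib, sub_nonneg]
    rcases hk.eq_or_lt with rfl | hk
    · have h1 := hext n le_rfl fun _ => 1
      simp only [mul_one] at h1
      rw [sum_range_succ (fun i => if i < n then (v i / S) ^ 2 else 0), h1]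
      simp only [lt_irrefl, if_false, add_zero, div_pow]
      rw [← sum_div, ← sum_div, hfull, ← hS, div_le_div_iff₀ (by positivity) (by positivity)]
      nlinarith [mul_pos hSpos hS'pos]
    · have h1 := hext k (by omega) fun _ => 1
      simp only [mul_one] at h1
      rw [h1]
      exact hpart k (by omega)

open Finset in
/-- The variances of the OLS estimators in a straight-line regression. -/
theorem straight_line_ols_variance (m : ℕ) (h s : ℕ → ℝ) (A : Matrix (Fin m) (Fin 2) ℝ)
    (hA : A = Matrix.of fun i : Fin m => ![1, h i]) {M₁ M₂ D : ℝ}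
    (hM₁ : M₁ = ∑ i ∈ range m, h i) (hM₂ : M₂ = ∑ i ∈ range m, h i ^ 2)
    (hD : D = m * M₂ - M₁ ^ 2) :
    let V := (Aᵀ * A)⁻¹ * Aᵀ * (Matrix.diagonal fun j : Fin m => s j) * A * (Aᵀ * A)⁻¹
    V 0 0 = ∑ i ∈ range m, ((M₂ - M₁ * h i) / D) ^ 2 * s i ∧
      V 1 1 = ∑ i ∈ range m, ((m * h i - M₁) / D) ^ 2 * s i := by
  intro V
  have hG : Aᵀ * A = !![(m : ℝ), M₁; M₁, M₂] := by
    ext i j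
    fin_cases i <;> fin_cases j <;>
      simp [hA, Matrix.mul_apply, hM₁, hM₂, Finset.sum_range, pow_two]
  have hinv : (Aᵀ * A)⁻¹ = !![M₂ / D, -M₁ / D; -M₁ / D, m / D] := by
    rw [hG, Matrix.inv_def, Matrix.adjugate_fin_two_of, Matrix.det_fin_two_of,
      Ring.inverse_eq_inv', show (m : ℝ) * M₂ - M₁ * M₁ = D by rw [hD]; ring]
    ext i j
    fin_cases i <;> fin_cases j <;> simp [div_eq_inv_mul]
  have hV : ∀ i, V i i = ∑ j : Fin m, (((Aᵀ * A)⁻¹ * Aᵀ) i j) ^ 2 * s j := by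
    intro i
    have htr : A * (Aᵀ * A)⁻¹ = ((Aᵀ * A)⁻¹ * Aᵀ)ᵀ := by
      rw [Matrix.transpose_mul, Matrix.transpose_transpose, Matrix.transpose_nonsing_inv,
        Matrix.transpose_mul, Matrix.transpose_transpose]
    simp only [V]
    rw [Matrix.mul_assoc _ A, htr, Matrix.mul_apply]
    refine sum_congr rfl fun j _ => ?_
    rw [Matrix.mul_diagonal, Matrix.transpose_apply]
    ring
  rw [hV, hV, hinv, sum_range, sum_range]
  constructor <;> refine sum_congr rfl fun j _ => ?_ <;>
    simp only [hA, Matrix.mul_apply, Fin.sum_univ_two, Matrix.transpose_apply, Matrix.of_apply,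
      Matrix.cons_val_zero, Matrix.cons_val_one, Matrix.cons_val', Matrix.cons_val_fin_one] <;>
    ring

/-- Theorem 2.6: for a straight-line regression with non-negative,
strictly increasing design points and non-increasing variances, the OLS estimators of
both the intercept and the slope have the variance reduction property.
The design points `h₁,…,h_{n+1}` of the paper are `h 0, …, h n`. -/
theorem vrp_straight_line_increasing_design
    (n : ℕ) (hn : 2 ≤ n) (h : ℕ → ℝ)
    (hh0 : 0 ≤ h 0) (hhinc : ∀ i, i < n → h i < h (i + 1))
    (σ : Fin (n + 1) → ℝ)
    (hσmono : ∀ p q : Fin (n + 1), p ≤ q → σ q ^ 2 ≤ σ p ^ 2)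
    (hσlast : 0 < σ (Fin.last n) ^ 2)
    (A₀ : Matrix (Fin n) (Fin 2) ℝ) (A₁ : Matrix (Fin (n + 1)) (Fin 2) ℝ)
    (hA₀ : A₀ = Matrix.of fun i : Fin n => ![1, h i])
    (hA₁ : A₁ = Matrix.of fun i : Fin (n + 1) => ![1, h i])
    (hA₀full : IsUnit (A₀ᵀ * A₀).det) (hA₁full : IsUnit (A₁ᵀ * A₁).det) :
    let Sig₀ : Matrix (Fin n) (Fin n) ℝ :=
      Matrix.diagonal fun j => σ (Fin.castSucc j) ^ 2
    let Sig₁ : Matrix (Fin (n + 1)) (Fin (n + 1)) ℝ :=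
      Matrix.diagonal fun j => σ j ^ 2
    let V₀₀ := (A₀ᵀ * A₀)⁻¹ * A₀ᵀ * Sig₀ * A₀ * (A₀ᵀ * A₀)⁻¹
    let V₁₁ := (A₁ᵀ * A₁)⁻¹ * A₁ᵀ * Sig₁ * A₁ * (A₁ᵀ * A₁)⁻¹
    ∀ i : Fin 2, V₁₁ i i ≤ V₀₀ i i := by
  intro Sig₀ Sig₁ V₀₀ V₁₁
  obtain ⟨s, hsdef⟩ : ∃ s : ℕ → ℝ, ∀ j : Fin (n + 1), s j = σ j ^ 2 :=
    ⟨fun i => if hi : i < n + 1 then σ ⟨i, hi⟩ ^ 2 else 0, fun j => by simp [j.is_lt]⟩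
  have hs : ∀ i, i + 1 < n + 1 → s (i + 1) ≤ s i := fun i hi => by
    have h1 := hsdef ⟨i + 1, hi⟩
    have h2 := hsdef ⟨i, by omega⟩
    simp only at h1 h2
    rw [h1, h2]
    exact hσmono _ _ (by simp)
  have hs0 : ∀ i < n + 1, 0 ≤ s i := fun i hi => by
    have h1 := hsdef ⟨i, hi⟩
    simp only at h1
    rw [h1]
    positivity
  have hSig₀ : Sig₀ = Matrix.diagonal fun j : Fin n => s j := by
    simp only [Sig₀]
    congr 1
    ext j
    exact (hsdef j.castSucc).symm
  have hSig₁ : Sig₁ = Matrix.diagonal fun j : Fin (n + 1) => s j := by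
    simp only [Sig₁, hsdef]
  have hlt : ∀ i j, i < j → j ≤ n → h i < h j := by
    intro i j hij
    induction j, hij using Nat.le_induction with
    | base => intro hj; exact hhinc i hj
    | succ j _ ih => intro hj; exact (ih (by omega)).trans (hhinc j hj)
  have hpos : ∀ i, 0 < i → i ≤ n → 0 < h i := fun i hi hin => hh0.trans_lt (hlt 0 i hi hin)
  obtain ⟨M₁, hM₁⟩ : ∃ M₁, M₁ = ∑ i ∈ Finset.range n, h i := ⟨_, rfl⟩
  obtain ⟨M₂, hM₂⟩ : ∃ M₂, M₂ = ∑ i ∈ Finset.range n, h i ^ 2 := ⟨_, rfl⟩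
  obtain ⟨D, hD⟩ : ∃ D, D = n * M₂ - M₁ ^ 2 := ⟨_, rfl⟩
  obtain ⟨D', hD'⟩ : ∃ D', D' = (n + 1 : ℕ) * (M₂ + h n ^ 2) - (M₁ + h n) ^ 2 := ⟨_, rfl⟩
  have hM₁' : M₁ + h n = ∑ i ∈ Finset.range (n + 1), h i := by rw [Finset.sum_range_succ, hM₁]
  have hM₂' : M₂ + h n ^ 2 = ∑ i ∈ Finset.range (n + 1), h i ^ 2 := by
    rw [Finset.sum_range_succ, hM₂]
  obtain ⟨h00, h01⟩ := straight_line_ols_variance n h s A₀ hA₀ hM₁ hM₂ hD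
  obtain ⟨h10, h11⟩ := straight_line_ols_variance (n + 1) h s A₁ hA₁ hM₁' hM₂' hD'
  rw [← hSig₀] at h00 h01
  rw [← hSig₁] at h10 h11
  have hn0 : (0 : ℝ) < n := by exact_mod_cast (by omega : 0 < n)
  have hxpos := hpos n (by omega) le_rfl
  have h1mem : 1 ∈ Finset.range n := by simp; omega
  have hnn : ∀ i ∈ Finset.range n, h 0 ≤ h i := fun i hi => by
    rcases Nat.eq_zero_or_pos i with rfl | hi0
    · exact le_rfl
    · exact (hlt 0 i hi0 (Finset.mem_range.1 hi).le).le
  have h1pos := hpos 1 one_pos (by omega)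
  have hM₂pos : 0 < M₂ := by
    rw [hM₂]
    exact Finset.sum_pos' (fun i _ => sq_nonneg _) ⟨1, h1mem, by positivity⟩
  have hmean : n * h 0 < M₁ := by
    have : ∑ i ∈ Finset.range n, h 0 < ∑ i ∈ Finset.range n, h i :=
      Finset.sum_lt_sum hnn ⟨1, h1mem, hlt 0 1 one_pos (by omega)⟩
    simpa [← hM₁] using this
  have hmean₂ : M₁ * h 0 < M₂ := by
    rw [hM₁, hM₂, Finset.sum_mul]
    refine Finset.sum_lt_sum (fun i hi => ?_) ⟨1, h1mem, ?_⟩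
    · nlinarith [hnn i hi]
    · nlinarith [hlt 0 1 one_pos (by omega)]
  have hquad : ∀ a b : ℝ, ∑ i ∈ Finset.range n, (a * h i - b) ^ 2
      = a ^ 2 * M₂ - 2 * a * b * M₁ + n * b ^ 2 := fun a b => by
    rw [hM₁, hM₂, Finset.mul_sum, Finset.mul_sum, ← Finset.sum_sub_distrib,
      show (n : ℝ) * b ^ 2 = ∑ i ∈ Finset.range n, b ^ 2 by simp, ← Finset.sum_add_distrib]
    exact Finset.sum_congr rfl fun i _ => by ring
  have hDpos : 0 < D := by
    have h1 : 0 < ∑ i ∈ Finset.range n, (n * h i - M₁) ^ 2 :=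
      Finset.sum_pos' (fun i _ => sq_nonneg _)
        ⟨0, by simp; omega, sq_pos_of_neg (by linarith)⟩
    rw [hquad] at h1
    have : (n : ℝ) ^ 2 * M₂ - 2 * n * M₁ * M₁ + n * M₁ ^ 2 = n * D := by rw [hD]; ring
    rw [this] at h1
    exact pos_of_mul_pos_right h1 hn0.le
  have hD'eq : D' = D + (n * h n ^ 2 - 2 * h n * M₁ + M₂) := by
    rw [hD', hD]; push_cast; ring
  have hD'pos : 0 < D' := by
    have : 0 ≤ ∑ i ∈ Finset.range n, (1 * h i - h n) ^ 2 :=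
      Finset.sum_nonneg fun i _ => sq_nonneg _
    rw [hquad] at this
    rw [hD'eq]; linarith
  have hscale : ∀ (c : ℝ) (m : ℕ) (f g : ℕ → ℝ), (∀ i, f i = c * g i) →
      ∑ i ∈ Finset.range m, f i ^ 2 * s i = c ^ 2 * ∑ i ∈ Finset.range m, g i ^ 2 * s i :=
    fun c m f g hfg => by
      rw [Finset.mul_sum]
      exact Finset.sum_congr rfl fun i _ => by rw [hfg]; ring
  intro i
  fin_cases i
  · change V₁₁ 0 0 ≤ V₀₀ 0 0
    refine h10.le.trans (le_trans ?_ h00.ge)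
    have hsum := variance_update_le (u := h) (v := fun i => M₁ * h i - M₂) (s := s) hn hh0 hpos
      (by linarith) (fun i j hij hj => by nlinarith [hlt i j hij hj])
      (by
        have : ∀ i ∈ Finset.range n, h i * (M₁ * h i - M₂) = M₁ * h i ^ 2 - M₂ * h i :=
          fun i _ => by ring
        rw [Finset.sum_congr rfl this, Finset.sum_sub_distrib, ← Finset.mul_sum,
          ← Finset.mul_sum, ← hM₁, ← hM₂]
        ring) hs hs0 hM₂ (S := M₂ * D) (by rw [hquad, hD]; ring) rfl rfl
    have hden : 0 < M₂ + h n ^ 2 := by positivity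
    have hS' : M₂ * D + (M₁ * h n - M₂) ^ 2 * M₂ / (M₂ + h n ^ 2)
        = M₂ ^ 2 * D' / (M₂ + h n ^ 2) := by
      rw [hD'eq, hD]; field_simp; ring
    simp only [hS'] at hsum
    rw [hscale (-M₂) (n + 1) _ _ (fun i => ?_), hscale (-M₂) n _ _ (fun i => ?_)]
    · exact mul_le_mul_of_nonneg_left hsum (sq_nonneg _)
    · field_simp; ring
    · field_simp; ring
  · change V₁₁ 1 1 ≤ V₀₀ 1 1
    refine h11.le.trans (le_trans ?_ h01.ge)
    have hsum := variance_update_le (u := fun _ => 1) (v := fun i => n * h i - M₁) (s := s) hn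
      zero_le_one (fun _ _ _ => one_pos)
      (by linarith) (fun i j hij hj => by nlinarith [hlt i j hij hj])
      (by simp [Finset.sum_sub_distrib, ← Finset.mul_sum, ← hM₁]) hs hs0 (U := n) (by simp)
      (S := n * D) (by rw [hquad, hD]; ring) rfl rfl
    have hS' : n * D + (n * h n - M₁) ^ 2 * n / (n + 1 ^ 2) = (n : ℝ) ^ 2 * D' / (n + 1) := by
      rw [hD'eq, hD]; field_simp; ring
    simp only [hS'] at hsum
    rw [hscale n (n + 1) _ _ (fun i => ?_), hscale n n _ _ (fun i => ?_)]
    · exact mul_le_mul_of_nonneg_left hsum (sq_nonneg _)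
    · field_simp
    · push_cast; field_simp; ring
end

section
/- Let b ≠ c be reals and suppose hᵢ = b if i is odd and hᵢ = c if i is even, for i = 1,…,n+1 (two-point alternating design). If σ₁² ≥ σ₂² ≥ ⋯ ≥ σ_{n+1}² > 0 (non-increasing variances), then V₁₁(i,i) ≤ V₀₀(i,i) for i = 1, 2; that is, the OLS estimators of both the intercept and the slope have the variance reduction property. -/
open Matrix

/-- The incidence matrix of a grouping `g`: row `i` is the indicator of the group of `i`. -/
def groupIncidence {ι κ : Type*} [DecidableEq κ] (g : ι → κ) : Matrix ι κ ℝ :=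
  Matrix.of fun i k => if g i = k then 1 else 0

lemma groupIncidence_gram {ι κ : Type*} [Fintype ι] [DecidableEq ι] [DecidableEq κ]
    (g : ι → κ) (v : ι → ℝ) :
    (groupIncidence g)ᵀ * diagonal v * groupIncidence g =
      diagonal fun k => ∑ i, if g i = k then v i else 0 := by
  ext k l
  rw [mul_apply]
  simp only [mul_diagonal, transpose_apply, groupIncidence, of_apply, diagonal_apply]
  split_ifs with hkl
  · subst hkl
    refine Finset.sum_congr rfl fun i _ => ?_
    split_ifs <;> simp
  · refine Finset.sum_eq_zero fun i _ => ?_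
    by_cases hk : g i = k
    · have : g i ≠ l := fun hl => hkl (hk.symm.trans hl)
      simp [this]
    · simp [hk]

/-- In a saturated grouped design `E * B` with `B` invertible, the variance of an OLS coefficient
is a nonnegative combination of the variances of the group means. -/
lemma ols_variance_grouped {ι κ : Type*} [Fintype ι] [DecidableEq ι] [Fintype κ] [DecidableEq κ]
    (g : ι → κ) (v : ι → ℝ) (B : Matrix κ κ ℝ) (hB : IsUnit B.det)
    (hg : ∀ k, (∑ i, if g i = k then (1 : ℝ) else 0) ≠ 0)
    (A : Matrix ι κ ℝ) (hA : A = groupIncidence g * B) (j : κ) :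
    ((Aᵀ * A)⁻¹ * Aᵀ * diagonal v * A * (Aᵀ * A)⁻¹) j j =
      ∑ k, B⁻¹ j k ^ 2 *
        ((∑ i, if g i = k then v i else 0) / (∑ i, if g i = k then (1 : ℝ) else 0) ^ 2) := by
  set m : κ → ℝ := fun k => ∑ i, if g i = k then (1 : ℝ) else 0
  set S : κ → ℝ := fun k => ∑ i, if g i = k then v i else 0 with hS
  have gram (w : ι → ℝ) : Aᵀ * diagonal w * A =
      Bᵀ * (diagonal fun k => ∑ i, if g i = k then w i else 0) * B := by
    rw [← groupIncidence_gram, hA, transpose_mul]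
    simp only [Matrix.mul_assoc]
  have gram_one : Aᵀ * A = Bᵀ * diagonal m * B := by
    simpa only [diagonal_one, Matrix.mul_one] using gram fun _ => 1
  have inv_m : (diagonal m)⁻¹ = diagonal fun k => (m k)⁻¹ := by
    refine inv_eq_left_inv ?_
    rw [diagonal_mul_diagonal, ← diagonal_one]
    congr 1
    funext k
    exact inv_mul_cancel₀ (hg k)
  have hBt : IsUnit Bᵀ.det := by rwa [det_transpose]
  have key : (Aᵀ * A)⁻¹ * Aᵀ * diagonal v * A * (Aᵀ * A)⁻¹ =
      B⁻¹ * (diagonal fun k => S k / m k ^ 2) * (B⁻¹)ᵀ := by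
    calc _ = (Aᵀ * A)⁻¹ * (Aᵀ * diagonal v * A) * (Aᵀ * A)⁻¹ := by
          simp only [Matrix.mul_assoc]
      _ = B⁻¹ * (diagonal m)⁻¹ * ((Bᵀ)⁻¹ * Bᵀ) * diagonal S * (B * B⁻¹) * (diagonal m)⁻¹
            * (Bᵀ)⁻¹ := by
          rw [gram v, gram_one, Matrix.mul_inv_rev, Matrix.mul_inv_rev]
          simp only [Matrix.mul_assoc, hS]
      _ = B⁻¹ * (diagonal m)⁻¹ * diagonal S * (diagonal m)⁻¹ * (Bᵀ)⁻¹ := by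
          rw [nonsing_inv_mul _ hBt, mul_nonsing_inv _ hB, Matrix.mul_one, Matrix.mul_one]
      _ = _ := by
          rw [inv_m, transpose_nonsing_inv, Matrix.mul_assoc B⁻¹, Matrix.mul_assoc B⁻¹,
            diagonal_mul_diagonal, diagonal_mul_diagonal]
          congr 3
          funext k
          ring
  rw [key, mul_apply]
  refine Finset.sum_congr rfl fun k _ => ?_
  rw [mul_diagonal, transpose_apply]
  ring

/-- Adding an observation whose variance does not exceed the earlier ones does not increase
the variance of a group mean. -/
lemma group_mean_variance_antitone {κ : Type*} [DecidableEq κ] {n : ℕ} (g : Fin (n + 1) → κ)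
    (v : Fin (n + 1) → ℝ) (hv : ∀ i, v (Fin.last n) ≤ v i) (hlast : 0 ≤ v (Fin.last n)) (k : κ)
    (hk : 0 < ∑ i : Fin n, if g i.castSucc = k then (1 : ℝ) else 0) :
    (∑ i, if g i = k then v i else 0) / (∑ i, if g i = k then (1 : ℝ) else 0) ^ 2 ≤
      (∑ i : Fin n, if g i.castSucc = k then v i.castSucc else 0) /
        (∑ i : Fin n, if g i.castSucc = k then (1 : ℝ) else 0) ^ 2 := by
  have hS : (∑ i : Fin n, if g i.castSucc = k then (1 : ℝ) else 0) * v (Fin.last n) ≤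
      ∑ i : Fin n, if g i.castSucc = k then v i.castSucc else 0 := by
    rw [Finset.sum_mul]
    refine Finset.sum_le_sum fun i _ => ?_
    split_ifs
    · simpa using hv i.castSucc
    · simp
  simp only [Fin.sum_univ_castSucc]
  generalize (∑ i : Fin n, if g i.castSucc = k then (1 : ℝ) else 0) = m at *
  generalize (∑ i : Fin n, if g i.castSucc = k then v i.castSucc else 0) = S at *
  split_ifs
  · rw [div_le_div_iff₀ (by positivity) (by positivity)]
    have hS0 : 0 ≤ S := le_trans (by positivity) hS
    nlinarith [mul_le_mul_of_nonneg_left hS hk.le, mul_nonneg hk.le hS0]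
  · simp

/-- Theorem 2.7: for the two-point alternating straight-line design
(`hᵢ = b` if `i` is odd, `hᵢ = c` if `i` is even, in the paper's 1-based indexing;
here `h i = b` for even 0-based `i`) with non-increasing variances, the OLS estimators
of both the intercept and the slope have the variance reduction property. -/
theorem vrp_two_point_alternating_design
    (n : ℕ) (hn : 2 ≤ n) (b c : ℝ) (hbc : b ≠ c) (h : ℕ → ℝ)
    (hh : ∀ i ≤ n, h i = if i % 2 = 0 then b else c)
    (σ : Fin (n + 1) → ℝ)
    (hσmono : ∀ p q : Fin (n + 1), p ≤ q → σ q ^ 2 ≤ σ p ^ 2)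
    (hσlast : 0 < σ (Fin.last n) ^ 2)
    (A₀ : Matrix (Fin n) (Fin 2) ℝ) (A₁ : Matrix (Fin (n + 1)) (Fin 2) ℝ)
    (hA₀ : A₀ = Matrix.of fun i : Fin n => ![1, h i])
    (hA₁ : A₁ = Matrix.of fun i : Fin (n + 1) => ![1, h i])
    (hA₀full : IsUnit (A₀ᵀ * A₀).det) (hA₁full : IsUnit (A₁ᵀ * A₁).det) :
    let Sig₀ : Matrix (Fin n) (Fin n) ℝ :=
      Matrix.diagonal fun j => σ (Fin.castSucc j) ^ 2
    let Sig₁ : Matrix (Fin (n + 1)) (Fin (n + 1)) ℝ :=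
      Matrix.diagonal fun j => σ j ^ 2
    let V₀₀ := (A₀ᵀ * A₀)⁻¹ * A₀ᵀ * Sig₀ * A₀ * (A₀ᵀ * A₀)⁻¹
    let V₁₁ := (A₁ᵀ * A₁)⁻¹ * A₁ᵀ * Sig₁ * A₁ * (A₁ᵀ * A₁)⁻¹
    ∀ i : Fin 2, V₁₁ i i ≤ V₀₀ i i := by
  intro Sig₀ Sig₁ V₀₀ V₁₁ j
  let g : Fin (n + 1) → Fin 2 := fun i => if (i : ℕ) % 2 = 0 then 0 else 1
  let B : Matrix (Fin 2) (Fin 2) ℝ := !![1, b; 1, c]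
  have hB : IsUnit B.det := by
    rw [isUnit_iff_ne_zero, det_fin_two_of]
    intro h0
    exact hbc (by linarith)
  have hA₁B : A₁ = groupIncidence g * B := by
    ext i l
    have hi := hh i (Nat.lt_succ_iff.mp i.isLt)
    fin_cases l <;> by_cases hp : (i : ℕ) % 2 = 0 <;>
      simp [hA₁, groupIncidence, mul_apply, B, g, hi, hp]
  have hA₀B : A₀ = groupIncidence (fun i : Fin n => g i.castSucc) * B := by
    ext i l
    have hi := hh i i.isLt.le
    fin_cases l <;> by_cases hp : (i : ℕ) % 2 = 0 <;>
      simp [hA₀, groupIncidence, mul_apply, B, g, hi, hp]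
  have hm₀ (k : Fin 2) : 0 < ∑ i : Fin n, if g i.castSucc = k then (1 : ℝ) else 0 := by
    refine Finset.sum_pos' (fun i _ => by split_ifs <;> norm_num)
      ⟨⟨k, k.isLt.trans_le hn⟩, Finset.mem_univ _, ?_⟩
    fin_cases k <;> simp [g]
  have hm₁ (k : Fin 2) : 0 < ∑ i, if g i = k then (1 : ℝ) else 0 := by
    rw [Fin.sum_univ_castSucc]
    exact add_pos_of_pos_of_nonneg (hm₀ k) (by split_ifs <;> norm_num)
  have hV₁ := ols_variance_grouped g (fun i => σ i ^ 2) B hB (fun k => (hm₁ k).ne') A₁ hA₁B j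
  have hV₀ := ols_variance_grouped (fun i : Fin n => g i.castSucc) (fun i => σ i.castSucc ^ 2)
    B hB (fun k => (hm₀ k).ne') A₀ hA₀B j
  refine hV₁.trans_le (le_of_le_of_eq ?_ hV₀.symm)
  refine Finset.sum_le_sum fun k _ => mul_le_mul_of_nonneg_left ?_ (sq_nonneg _)
  exact group_mean_variance_antitone g (fun i => σ i ^ 2)
    (fun i => hσmono i _ (Fin.le_last i)) hσlast.le k (hm₀ k)
end

section
/- Assume Vₙ ≠ 0 and V_{n+1} ≠ 0. Let D = diag(D₁,…,Dₙ) be any real diagonal n×n matrix, and set δ₁₁ = ∑_{i=1}^n Dᵢ, δ₁ₕ = ∑_{i=1}^n Dᵢhᵢ, δₕₕ = ∑_{i=1}^n Dᵢhᵢ². Then the diagonal entries of W₁₁ = (A₀ᵀA₀)⁻¹A₀ᵀDA₀(A₀ᵀA₀)⁻¹ − (A₁ᵀA₁)⁻¹A₀ᵀDA₀(A₁ᵀA₁)⁻¹ are W₁₁(1,1) = (α₁δ₁₁ − 2α₂δ₁ₕ + α₃δₕₕ)/((n+1)⁴·V_{n+1}²) and W₁₁(2,2) = (α₃δ₁₁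 − 2α₄δ₁ₕ + α₅δₕₕ)/((n+1)⁴·V_{n+1}²). -/
open Matrix

/-- `S₁ₘ = ∑_{i=1}^m hᵢ` (paper's `hᵢ` is `h (i-1)`). -/
noncomputable def S1 (h : ℕ → ℝ) (m : ℕ) : ℝ := ∑ i ∈ Finset.range m, h i

/-- `S₂ₘ = ∑_{i=1}^m hᵢ²`. -/
noncomputable def S2 (h : ℕ → ℝ) (m : ℕ) : ℝ := ∑ i ∈ Finset.range m, (h i) ^ 2

/-- `Vₘ = S₂ₘ/m − (S₁ₘ/m)²`. -/
noncomputable def Vm (h : ℕ → ℝ) (m : ℕ) : ℝ := S2 h m / m - (S1 h m / m) ^ 2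

/-- `q = 1 + (1/n)·((S₁ₙ − n h_{n+1})²/(n² Vₙ) + 1)`. -/
noncomputable def qq (h : ℕ → ℝ) (n : ℕ) : ℝ :=
  1 + (1 / (n : ℝ)) * ((S1 h n - n * h n) ^ 2 / ((n : ℝ) ^ 2 * Vm h n) + 1)

noncomputable def aCoef (h : ℕ → ℝ) (n : ℕ) : Fin 6 → ℝ :=
  ![qq h n * S2 h n, S2 h (n + 1), qq h n * S1 h n, S1 h (n + 1), (n : ℝ) * qq h n, (n : ℝ) + 1]

noncomputable def αCoef (h : ℕ → ℝ) (n : ℕ) : Fin 5 → ℝ :=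
  ![(aCoef h n 0) ^ 2 - (aCoef h n 1) ^ 2,
    aCoef h n 0 * aCoef h n 2 - aCoef h n 1 * aCoef h n 3,
    (aCoef h n 2) ^ 2 - (aCoef h n 3) ^ 2,
    aCoef h n 2 * aCoef h n 4 - aCoef h n 3 * aCoef h n 5,
    (aCoef h n 4) ^ 2 - (aCoef h n 5) ^ 2]

/-- The design matrix of the straight-line model on the first `m` points. -/
def lineDesign (h : ℕ → ℝ) (m : ℕ) : Matrix (Fin m) (Fin 2) ℝ :=
  Matrix.of fun i : Fin m => ![1, h i]

theorem lineDesign_weighted_gram (h w : ℕ → ℝ) (m : ℕ) :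
    (lineDesign h m)ᵀ * Matrix.diagonal (fun i : Fin m => w i) * lineDesign h m =
      !![∑ i ∈ Finset.range m, w i, ∑ i ∈ Finset.range m, w i * h i;
        ∑ i ∈ Finset.range m, w i * h i, ∑ i ∈ Finset.range m, w i * h i ^ 2] := by
  ext a b
  rw [Matrix.mul_apply]
  simp only [Matrix.mul_diagonal]
  fin_cases a <;> fin_cases b <;>
    simp [lineDesign, Finset.sum_range, pow_two, mul_comm, mul_left_comm]

theorem lineDesign_gram (h : ℕ → ℝ) (m : ℕ) :
    (lineDesign h m)ᵀ * lineDesign h m = !![(m : ℝ), S1 h m; S1 h m, S2 h m] := by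
  simpa [S1, S2] using lineDesign_weighted_gram h (fun _ => 1) m

theorem mul_S2_sub_S1_sq (h : ℕ → ℝ) {m : ℕ} (hm : m ≠ 0) :
    (m : ℝ) * S2 h m - S1 h m ^ 2 = (m : ℝ) ^ 2 * Vm h m := by
  have : (m : ℝ) ≠ 0 := Nat.cast_ne_zero.mpr hm
  unfold Vm
  field_simp

theorem inv_symm_two {a b c : ℝ} :
    (!![a, b; b, c])⁻¹ = (a * c - b ^ 2)⁻¹ • !![c, -b; -b, a] := by
  rw [Matrix.inv_def, Matrix.det_fin_two_of, Matrix.adjugate_fin_two_of, Ring.inverse_eq_inv',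
    pow_two]

theorem lineDesign_gram_inv (h : ℕ → ℝ) {m : ℕ} (hm : m ≠ 0) :
    ((lineDesign h m)ᵀ * lineDesign h m)⁻¹ =
      ((m : ℝ) ^ 2 * Vm h m)⁻¹ • !![S2 h m, -S1 h m; -S1 h m, (m : ℝ)] := by
  rw [lineDesign_gram, inv_symm_two, mul_S2_sub_S1_sq h hm]

/-- The factor `q` is the ratio of the Gram determinants for `n + 1` and `n` points. -/
theorem qq_mul_gram_det (h : ℕ → ℝ) {n : ℕ} (hn : n ≠ 0) (hV : Vm h n ≠ 0) :
    qq h n * ((n : ℝ) ^ 2 * Vm h n) = ((n : ℝ) + 1) ^ 2 * Vm h (n + 1) := by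
  have hn' : (n : ℝ) ≠ 0 := Nat.cast_ne_zero.mpr hn
  have h0 := mul_S2_sub_S1_sq h hn
  have h1 := mul_S2_sub_S1_sq h n.succ_ne_zero
  have e1 : S1 h (n + 1) = S1 h n + h n := Finset.sum_range_succ _ _
  have e2 : S2 h (n + 1) = S2 h n + h n ^ 2 := Finset.sum_range_succ _ _
  rw [Nat.succ_eq_add_one, e1, e2] at h1
  push_cast at h1
  rw [← h1]
  have hq : qq h n * ((n : ℝ) ^ 2 * Vm h n) = (n : ℝ) ^ 2 * Vm h n +
      ((S1 h n - n * h n) ^ 2 + (n : ℝ) ^ 2 * Vm h n) / n := by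
    unfold qq
    field_simp
  rw [hq, ← h0]
  field_simp
  ring

/-- The inverse Gram matrix on `n` points, over the Gram determinant on `n + 1` points. -/
theorem lineDesign_gram_inv_eq_qq_smul (h : ℕ → ℝ) {n : ℕ} (hn : n ≠ 0) (hV : Vm h n ≠ 0)
    (hV1 : Vm h (n + 1) ≠ 0) :
    ((lineDesign h n)ᵀ * lineDesign h n)⁻¹ = (((n : ℝ) + 1) ^ 2 * Vm h (n + 1))⁻¹ •
      !![qq h n * S2 h n, -(qq h n * S1 h n); -(qq h n * S1 h n), (n : ℝ) * qq h n] := by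
  have hq := qq_mul_gram_det h hn hV
  have hq0 : qq h n ≠ 0 := by
    intro h0
    rw [h0, zero_mul] at hq
    exact mul_ne_zero (by positivity) hV1 hq.symm
  rw [lineDesign_gram_inv h hn, ← hq, mul_inv]
  ext a b
  fin_cases a <;> fin_cases b <;> simp <;> field_simp

/-- Proposition 3.2: the diagonal entries of `W₁₁` in the
straight-line model. -/
theorem W11_diag_straight_line
    (n : ℕ) (hn : 2 ≤ n) (h : ℕ → ℝ)
    (hVn : Vm h n ≠ 0) (hVn1 : Vm h (n + 1) ≠ 0)
    (A₀ : Matrix (Fin n) (Fin 2) ℝ) (A₁ : Matrix (Fin (n + 1)) (Fin 2) ℝ)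
    (hA₀ : A₀ = Matrix.of fun i : Fin n => ![1, h i])
    (hA₁ : A₁ = Matrix.of fun i : Fin (n + 1) => ![1, h i])
    (hA₀full : IsUnit (A₀ᵀ * A₀).det) (hA₁full : IsUnit (A₁ᵀ * A₁).det)
    (D : ℕ → ℝ) :
    let Dmat : Matrix (Fin n) (Fin n) ℝ := Matrix.diagonal fun i => D i
    let δ11 : ℝ := ∑ i ∈ Finset.range n, D i
    let δ1h : ℝ := ∑ i ∈ Finset.range n, D i * h i
    let δhh : ℝ := ∑ i ∈ Finset.range n, D i * (h i) ^ 2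
    let D₁₁ := A₀ᵀ * Dmat * A₀
    let W₁₁ := (A₀ᵀ * A₀)⁻¹ * D₁₁ * (A₀ᵀ * A₀)⁻¹ - (A₁ᵀ * A₁)⁻¹ * D₁₁ * (A₁ᵀ * A₁)⁻¹
    W₁₁ 0 0 = (αCoef h n 0 * δ11 - 2 * αCoef h n 1 * δ1h + αCoef h n 2 * δhh) /
        (((n : ℝ) + 1) ^ 4 * (Vm h (n + 1)) ^ 2) ∧
    W₁₁ 1 1 = (αCoef h n 2 * δ11 - 2 * αCoef h n 3 * δ1h + αCoef h n 4 * δhh) /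
        (((n : ℝ) + 1) ^ 4 * (Vm h (n + 1)) ^ 2) := by
  intro Dmat δ11 δ1h δhh D₁₁ W₁₁
  have hn0 : n ≠ 0 := by lia
  have hD : D₁₁ = !![δ11, δ1h; δ1h, δhh] := by
    subst hA₀
    exact lineDesign_weighted_gram h D n
  have hI₀ := lineDesign_gram_inv_eq_qq_smul h hn0 hVn hVn1
  have hI₁ := lineDesign_gram_inv h n.succ_ne_zero
  rw [Nat.succ_eq_add_one, Nat.cast_add_one] at hI₁
  change A₀ = lineDesign h n at hA₀
  change A₁ = lineDesign h (n + 1) at hA₁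
  rw [← hA₀] at hI₀
  rw [← hA₁] at hI₁
  have hpos : (n : ℝ) + 1 ≠ 0 := by positivity
  have hW : W₁₁ = (A₀ᵀ * A₀)⁻¹ * D₁₁ * (A₀ᵀ * A₀)⁻¹ - (A₁ᵀ * A₁)⁻¹ * D₁₁ * (A₁ᵀ * A₁)⁻¹ := rfl
  rw [hW, hI₀, hI₁, hD]
  clear_value δ11 δ1h δhh
  constructor <;>
  · simp [αCoef, aCoef]
    field_simp
    ring
end

section
/- Assume 0 ≤ h₁ < h₂ < ⋯ < h_{n+1}. Then the following are equivalent: (i) for every m = 1,…,n, both α₁ − 2α₂·(S₁ₘ/m) + α₃·(S₂ₘ/m) ≥ 0 and α₃ − 2α₄·(S₁ₘ/m) + α₅·(S₂ₘ/m) ≥ 0; (ii) for every m = 1,…,n, (S₁ₘ/m − r₁₁)·(S₁ₘ/m − r₁₂) + Vₘ ≥ 0. -/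
open Matrix

/-- `r₁₁ = (a₁ − a₂)/(a₃ − a₄)`. -/
noncomputable def r11 (h : ℕ → ℝ) (n : ℕ) : ℝ :=
  (aCoef h n 0 - aCoef h n 1) / (aCoef h n 2 - aCoef h n 3)

/-- `r₁₂ = (a₁ + a₂)/(a₃ + a₄)`. -/
noncomputable def r12 (h : ℕ → ℝ) (n : ℕ) : ℝ :=
  (aCoef h n 0 + aCoef h n 1) / (aCoef h n 2 + aCoef h n 3)

lemma S1_succ (h : ℕ → ℝ) (m : ℕ) : S1 h (m + 1) = S1 h m + h m :=
  Finset.sum_range_succ _ _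

lemma S2_succ (h : ℕ → ℝ) (m : ℕ) : S2 h (m + 1) = S2 h m + h m ^ 2 :=
  Finset.sum_range_succ _ _

lemma S1_sq_le (h : ℕ → ℝ) (m : ℕ) : S1 h m ^ 2 ≤ m * S2 h m := by
  simpa [S1, S2] using sq_sum_le_card_mul_sum_sq (s := Finset.range m) (f := h)

lemma Vm_nonneg (h : ℕ → ℝ) {m : ℕ} (hm : 1 ≤ m) : 0 ≤ Vm h m := by
  have hm' : (0 : ℝ) < m := by exact_mod_cast hm
  have e : Vm h m = (m * S2 h m - S1 h m ^ 2) / m ^ 2 := by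
    unfold Vm
    field_simp
  rw [e]
  exact div_nonneg (sub_nonneg.2 (S1_sq_le h m)) (by positivity)

lemma apply_nonneg_of_increasing {n : ℕ} {h : ℕ → ℝ} (hh0 : 0 ≤ h 0)
    (hhinc : ∀ i, i < n → h i < h (i + 1)) : ∀ m ≤ n, 0 ≤ h m := by
  intro m
  induction m with
  | zero => exact fun _ => hh0
  | succ k ih => exact fun hk => (ih (by omega)).trans (hhinc k (by omega)).le

lemma S1_lt_mul {n : ℕ} {h : ℕ → ℝ} (hhinc : ∀ i, i < n → h i < h (i + 1)) {m : ℕ}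
    (hm : 1 ≤ m) : m ≤ n → S1 h m < m * h m := by
  induction m, hm using Nat.le_induction with
  | base =>
    intro h1
    simpa [S1] using hhinc 0 h1
  | succ k hk ih =>
    intro hkn
    have h1 := ih (by omega)
    have h2 := hhinc k (by omega)
    have hk' : (0 : ℝ) ≤ k := k.cast_nonneg
    rw [S1_succ]
    push_cast
    nlinarith

lemma S1_div_le_S1_div {n : ℕ} {h : ℕ → ℝ} (hhinc : ∀ i, i < n → h i < h (i + 1)) {m k : ℕ}
    (hm : 1 ≤ m) (hmk : m ≤ k) : k ≤ n → S1 h m / m ≤ S1 h k / k := by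
  induction k, hmk using Nat.le_induction with
  | base => exact fun _ => le_rfl
  | succ k hk ih =>
    intro hkn
    refine (ih (by omega)).trans ?_
    have h1 := S1_lt_mul hhinc (hm.trans hk) (by omega)
    have hk' : (0 : ℝ) < k := by exact_mod_cast hm.trans hk
    rw [S1_succ, div_le_div_iff₀ hk' (by positivity)]
    push_cast
    nlinarith

lemma S1_pos {n : ℕ} {h : ℕ → ℝ} (hh0 : 0 ≤ h 0) (hhinc : ∀ i, i < n → h i < h (i + 1))
    (hn : 2 ≤ n) : 0 < S1 h n := by
  refine Finset.sum_pos' (fun i hi => apply_nonneg_of_increasing hh0 hhinc i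
    (Finset.mem_range.1 hi).le) ⟨1, Finset.mem_range.2 (by omega), ?_⟩
  exact hh0.trans_lt (hhinc 0 (by omega))

lemma S2_le_mul_S1 {n : ℕ} {h : ℕ → ℝ} (hh0 : 0 ≤ h 0)
    (hhinc : ∀ i, i < n → h i < h (i + 1)) (m : ℕ) :
    m < n → S2 h (m + 1) ≤ h m * S1 h (m + 1) := by
  induction m with
  | zero =>
    intro _
    simp [S1, S2, sq]
  | succ k ih =>
    intro hk
    have h1 := ih (by omega)
    have h2 : 0 ≤ S1 h (k + 1) := Finset.sum_nonneg fun i hi =>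
      apply_nonneg_of_increasing hh0 hhinc i (by have := Finset.mem_range.1 hi; omega)
    have h3 := hhinc k (by omega)
    rw [S2_succ h (k + 1), S1_succ h (k + 1)]
    nlinarith

lemma S2_lt_mul_S1 {n : ℕ} {h : ℕ → ℝ} (hh0 : 0 ≤ h 0)
    (hhinc : ∀ i, i < n → h i < h (i + 1)) (hn : 2 ≤ n) : S2 h n < h n * S1 h n := by
  obtain ⟨k, rfl⟩ : ∃ k, n = k + 1 := ⟨n - 1, by omega⟩
  exact (S2_le_mul_S1 hh0 hhinc k (by omega)).trans_lt
    (mul_lt_mul_of_pos_right (hhinc k (by omega)) (S1_pos hh0 hhinc hn))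

lemma S1_sq_lt {n : ℕ} {h : ℕ → ℝ} (hhinc : ∀ i, i < n → h i < h (i + 1))
    (hn : 2 ≤ n) : S1 h n ^ 2 < n * S2 h n := by
  obtain ⟨k, rfl⟩ : ∃ k, n = k + 1 := ⟨n - 1, by omega⟩
  have hk : (0 : ℝ) < k := by exact_mod_cast (by omega : 0 < k)
  have h1 := S1_lt_mul hhinc (by omega : 1 ≤ k) (by omega)
  have h2 := S1_sq_le h k
  rw [S1_succ, S2_succ]
  push_cast
  have h3 : 0 < (k * h k - S1 h k) ^ 2 := by
    have := sub_pos.2 h1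
    positivity
  refine lt_of_mul_lt_mul_left ?_ hk.le
  nlinarith

/-- part of Theorem 3.3, C4 ⇔ C7: for non-negative strictly
increasing design points, the pair of partial-mean conditions is equivalent to the
single condition involving the monic driving polynomial `p̄₁`. -/
theorem C4_iff_C7
    (n : ℕ) (hn : 2 ≤ n) (h : ℕ → ℝ)
    (hh0 : 0 ≤ h 0) (hhinc : ∀ i, i < n → h i < h (i + 1)) :
    (∀ m : ℕ, 1 ≤ m → m ≤ n →
        0 ≤ αCoef h n 0 - 2 * αCoef h n 1 * (S1 h m / m) + αCoef h n 2 * (S2 h m / m) ∧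
        0 ≤ αCoef h n 2 - 2 * αCoef h n 3 * (S1 h m / m) + αCoef h n 4 * (S2 h m / m))
      ↔
    (∀ m : ℕ, 1 ≤ m → m ≤ n →
        0 ≤ (S1 h m / m - r11 h n) * (S1 h m / m - r12 h n) + Vm h m) := by
  have hn0 : (0 : ℝ) < n := by exact_mod_cast (by omega : 0 < n)
  have ha := S1_pos hh0 hhinc hn
  have hab := S2_lt_mul_S1 hh0 hhinc hn
  have hD := sub_pos.2 (S1_sq_lt hhinc hn)
  have hu := sub_pos.2 (S1_lt_mul hhinc (by omega : 1 ≤ n) le_rfl)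
  have hx := apply_nonneg_of_increasing hh0 hhinc n le_rfl
  have hq : qq h n = 1 + (1 / (n : ℝ)) *
      ((n * h n - S1 h n) ^ 2 / (n * S2 h n - S1 h n ^ 2) + 1) := by
    have e : (n : ℝ) ^ 2 * Vm h n = n * S2 h n - S1 h n ^ 2 := by
      unfold Vm
      field_simp
    rw [qq, e]
    ring
  have hmean : ∀ m : ℕ, 1 ≤ m → m ≤ n → S1 h m / m ≤ S1 h n / n :=
    fun m hm hmn => S1_div_le_S1_div hhinc hm hmn le_rfl
  have hCSn := S1_sq_le h n
  simp only [r11, r12, αCoef, aCoef, S1_succ, S2_succ, Matrix.cons_val]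
  generalize qq h n = q at hq ⊢
  generalize S1 h n = a at *
  generalize S2 h n = b at *
  generalize h n = x at *
  generalize (n : ℝ) = N at *
  set c := (N * x - a) ^ 2 / (N * b - a ^ 2) with hc
  set r := (x * a - b) / (N * x - a) with hr
  have hc0 : 0 < c := by positivity
  have hr0 : 0 < r := div_pos (by linarith) hu
  have hq0 : 0 < q := by rw [hq]; positivity
  have e1 : q * b - (b + x ^ 2) = c * r ^ 2 := by
    rw [hq, hc, hr]
    field_simp
    ring
  have e3 : q * a - (a + x) = c * r := by
    rw [hq, hc, hr]
    field_simp
    ring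
  have e5 : N * q - (N + 1) = c := by
    rw [hq]
    field_simp
    ring
  have hr11 : (q * b - (b + x ^ 2)) / (q * a - (a + x)) = r := by
    rw [e1, e3]
    field_simp
  rw [hr11]
  set A := q * b + (b + x ^ 2) with hA
  set B := q * a + (a + x) with hB
  set C := N * q + (N + 1) with hC
  have hB0 : 0 < B := by positivity
  have hC0 : 0 < C := by positivity
  have key1 : ∀ s w : ℝ, (q * b) ^ 2 - (b + x ^ 2) ^ 2
      - 2 * (q * b * (q * a) - (b + x ^ 2) * (a + x)) * s
      + ((q * a) ^ 2 - (a + x) ^ 2) * w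
      = c * r * B * ((s - r) * (s - A / B) + (w - s ^ 2)) := by
    intro s w
    have : c * r * B * ((s - r) * (s - A / B) + (w - s ^ 2))
        = c * r ^ 2 * A - (c * r ^ 2 * B + A * (c * r)) * s + c * r * B * w := by
      field_simp
      ring
    rw [this, ← e1, ← e3, hA, hB]
    ring
  have key2 : ∀ s w : ℝ, (q * a) ^ 2 - (a + x) ^ 2
      - 2 * (q * a * (N * q) - (a + x) * (N + 1)) * s
      + ((N * q) ^ 2 - (N + 1) ^ 2) * w
      = c * C * ((s - r) * (s - B / C) + (w - s ^ 2)) := by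
    intro s w
    have : c * C * ((s - r) * (s - B / C) + (w - s ^ 2))
        = c * r * B - (c * r * C + B * c) * s + c * C * w := by
      field_simp
      ring
    rw [this, ← e3, ← e5, hC, hB]
    ring
  have hroots : B / C ≤ A / B := by
    rw [div_le_div_iff₀ hC0 hB0]
    have hcross : 2 * (a * (a + x)) ≤ b * (N + 1) + (b + x ^ 2) * N := by
      nlinarith [sq_nonneg (N * x - a)]
    rw [hA, hB, hC]
    nlinarith [mul_le_mul_of_nonneg_left hcross hq0.le,
      mul_le_mul_of_nonneg_left hCSn (sq_nonneg q)]
  have hmean' : a / N ≤ B / C := by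
    rw [div_le_div_iff₀ hn0 hC0, hB, hC]
    nlinarith
  refine forall_congr' fun m => forall_congr' fun hm => forall_congr' fun hmn => ?_
  have hV := Vm_nonneg h hm
  have hs := (hmean m hm hmn).trans hmean'
  rw [key1, key2]
  change _ ↔ 0 ≤ (S1 h m / m - r) * (S1 h m / m - A / B) + Vm h m
  rw [show S2 h m / m - (S1 h m / m) ^ 2 = Vm h m from rfl,
    mul_nonneg_iff_of_pos_left (by positivity), mul_nonneg_iff_of_pos_left (by positivity)]
  refine ⟨And.left, fun H => ⟨H, ?_⟩⟩
  rcases le_total r (S1 h m / m) with hrs | hrs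
  · nlinarith [mul_le_mul_of_nonneg_left hroots (sub_nonneg.2 hrs)]
  · exact add_nonneg (mul_nonneg_of_nonpos_of_nonpos (by linarith) (by linarith)) hV
end

section
/- Assume Vₙ ≠ 0. Then α₂² − α₁·α₃ = q²·(S₂ₙ − S₁ₙ·h_{n+1})²·h_{n+1}² and α₄² − α₃·α₅ = q²·(S₁ₙ − n·h_{n+1})²; in particular both discriminant expressions are non-negative. -/
open Matrix

/-- Lemma A.2: closed forms for the discriminants of the two
driving polynomials; in particular both are non-negative. -/
theorem discriminants_closed_form
    (n : ℕ) (hn : 2 ≤ n) (h : ℕ → ℝ) (hVn : Vm h n ≠ 0) :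
    (αCoef h n 1) ^ 2 - αCoef h n 0 * αCoef h n 2 =
        (qq h n) ^ 2 * (S2 h n - S1 h n * h n) ^ 2 * (h n) ^ 2 ∧
    (αCoef h n 3) ^ 2 - αCoef h n 2 * αCoef h n 4 =
        (qq h n) ^ 2 * (S1 h n - n * h n) ^ 2 ∧
    0 ≤ (αCoef h n 1) ^ 2 - αCoef h n 0 * αCoef h n 2 ∧
    0 ≤ (αCoef h n 3) ^ 2 - αCoef h n 2 * αCoef h n 4 := by
  have hS1 : S1 h (n + 1) = S1 h n + h n := Finset.sum_range_succ _ _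
  have hS2 : S2 h (n + 1) = S2 h n + (h n) ^ 2 := Finset.sum_range_succ _ _
  have first : (αCoef h n 1) ^ 2 - αCoef h n 0 * αCoef h n 2 =
      (qq h n) ^ 2 * (S2 h n - S1 h n * h n) ^ 2 * (h n) ^ 2 := by
    simp only [αCoef, aCoef, Matrix.cons_val, hS1, hS2]
    ring
  have second : (αCoef h n 3) ^ 2 - αCoef h n 2 * αCoef h n 4 =
      (qq h n) ^ 2 * (S1 h n - n * h n) ^ 2 := by
    simp only [αCoef, aCoef, Matrix.cons_val, hS1]
    ring
  refine ⟨first, second, ?_, ?_⟩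
  · rw [first]
    positivity
  · rw [second]
    positivity
end

section
/- Assume 0 ≤ h₁ < h₂ < ⋯ < h_{n+1}. Then r₁₁ = r₂₁ = (S₂ₙ − S₁ₙ·h_{n+1})/(S₁ₙ − n·h_{n+1}); that is, the smaller roots of the two driving polynomials coincide and equal this common value. -/
open Matrix

/-- `r₂₁ = (a₄ − a₃)/(a₆ − a₅)`. -/
noncomputable def r21 (h : ℕ → ℝ) (n : ℕ) : ℝ :=
  (aCoef h n 3 - aCoef h n 2) / (aCoef h n 5 - aCoef h n 4)

theorem Vm_eq_sum_sq_sub_mean_div (h : ℕ → ℝ) {n : ℕ} (hn : n ≠ 0) :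
    Vm h n = (∑ i ∈ Finset.range n, (h i - S1 h n / n) ^ 2) / n := by
  have hn' : (n : ℝ) ≠ 0 := Nat.cast_ne_zero.mpr hn
  have key : ∑ i ∈ Finset.range n, (h i - S1 h n / n) ^ 2 =
      S2 h n - 2 * (S1 h n / n) * S1 h n + n * (S1 h n / n) ^ 2 := by
    simp only [sub_sq, Finset.sum_add_distrib, Finset.sum_sub_distrib, Finset.sum_const,
      Finset.card_range, nsmul_eq_mul, ← Finset.sum_mul, ← Finset.mul_sum]
    rw [S1, S2]
    ring
  rw [key, Vm]
  field_simp
  ring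

theorem Vm_pos {h : ℕ → ℝ} {n i j : ℕ} (hi : i < n) (hj : j < n) (hij : h i ≠ h j) :
    0 < Vm h n := by
  rw [Vm_eq_sum_sq_sub_mean_div h (by omega)]
  refine div_pos ?_ (Nat.cast_pos.mpr (by omega))
  have nonneg : ∀ k ∈ Finset.range n, 0 ≤ (h k - S1 h n / n) ^ 2 := fun _ _ => sq_nonneg _
  refine (Finset.sum_nonneg nonneg).lt_of_ne fun hzero => hij ?_
  have hall := (Finset.sum_eq_zero_iff_of_nonneg nonneg).mp hzero.symm
  have eq_mean : ∀ k < n, h k = S1 h n / n := fun k hk =>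
    sub_eq_zero.mp (sq_eq_zero_iff.mp (hall k (Finset.mem_range.mpr hk)))
  rw [eq_mean i hi, eq_mean j hj]

section CoefficientDifferences

variable {h : ℕ → ℝ} {n : ℕ}

theorem aCoef_zero_sub_one (hn : n ≠ 0) (hV : Vm h n ≠ 0) :
    aCoef h n 0 - aCoef h n 1 = (S2 h n - S1 h n * h n) ^ 2 / ((n : ℝ) ^ 2 * Vm h n) := by
  have hn' : (n : ℝ) ≠ 0 := Nat.cast_ne_zero.mpr hn
  have hS : S2 h (n + 1) = S2 h n + h n ^ 2 := Finset.sum_range_succ _ _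
  have hW : (n : ℝ) ^ 2 * Vm h n = n * S2 h n - S1 h n ^ 2 := by rw [Vm]; field_simp
  have hW0 : (n : ℝ) * S2 h n - S1 h n ^ 2 ≠ 0 := hW ▸ mul_ne_zero (pow_ne_zero 2 hn') hV
  simp only [aCoef, qq, hS, hW, Matrix.cons_val]
  field_simp
  ring

theorem aCoef_two_sub_three (hn : n ≠ 0) (hV : Vm h n ≠ 0) :
    aCoef h n 2 - aCoef h n 3 =
      (S1 h n - n * h n) * (S2 h n - S1 h n * h n) / ((n : ℝ) ^ 2 * Vm h n) := by
  have hn' : (n : ℝ) ≠ 0 := Nat.cast_ne_zero.mpr hn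
  have hS : S1 h (n + 1) = S1 h n + h n := Finset.sum_range_succ _ _
  have hW : (n : ℝ) ^ 2 * Vm h n = n * S2 h n - S1 h n ^ 2 := by rw [Vm]; field_simp
  have hW0 : (n : ℝ) * S2 h n - S1 h n ^ 2 ≠ 0 := hW ▸ mul_ne_zero (pow_ne_zero 2 hn') hV
  simp only [aCoef, qq, hS, hW, Matrix.cons_val]
  field_simp
  ring

theorem aCoef_four_sub_five (hn : n ≠ 0) :
    aCoef h n 4 - aCoef h n 5 = (S1 h n - n * h n) ^ 2 / ((n : ℝ) ^ 2 * Vm h n) := by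
  have hn' : (n : ℝ) ≠ 0 := Nat.cast_ne_zero.mpr hn
  simp only [aCoef, qq, Matrix.cons_val]
  rw [mul_add, ← mul_assoc, mul_one_div_cancel hn']
  ring

end CoefficientDifferences

/-- part of Lemma A.3, eq. (A.13): for non-negative strictly
increasing design points, the smaller roots of the two driving polynomials coincide:
`r₁₁ = r₂₁ = (S₂ₙ − S₁ₙ h_{n+1})/(S₁ₙ − n h_{n+1})`. -/
theorem smaller_roots_coincide
    (n : ℕ) (hn : 2 ≤ n) (h : ℕ → ℝ)
    (hh0 : 0 ≤ h 0) (hhinc : ∀ i, i < n → h i < h (i + 1)) :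
    r11 h n = (S2 h n - S1 h n * h n) / (S1 h n - n * h n) ∧
    r21 h n = (S2 h n - S1 h n * h n) / (S1 h n - n * h n) := by
  have hn0 : n ≠ 0 := by omega
  have hV : Vm h n ≠ 0 :=
    (Vm_pos (by omega : 0 < n) (by omega : 1 < n) (hhinc 0 (by omega)).ne).ne'
  have hW : (n : ℝ) ^ 2 * Vm h n ≠ 0 :=
    mul_ne_zero (pow_ne_zero 2 (Nat.cast_ne_zero.mpr hn0)) hV
  constructor
  · rw [r11, aCoef_zero_sub_one hn0 hV, aCoef_two_sub_three hn0 hV, div_div_div_cancel_right₀ hW,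
      sq]
    rcases eq_or_ne (S2 h n - S1 h n * h n) 0 with hE | hE
    · simp [hE]
    · exact mul_div_mul_right _ _ hE
  · rw [r21, ← neg_sub (aCoef h n 2), ← neg_sub (aCoef h n 4), neg_div_neg_eq,
      aCoef_two_sub_three hn0 hV, aCoef_four_sub_five hn0, div_div_div_cancel_right₀ hW, sq]
    rcases eq_or_ne (S1 h n - n * h n) 0 with hD | hD
    · simp [hD]
    · exact mul_div_mul_left _ _ hD
end

section
/- Assume 0 ≤ h₁ < h₂ < ⋯ < h_{n+1}. Then (S₁ₙ/n − r₁₁)·(S₁ₙ/n − r₁₂) + Vₙ = n·Vₙ·( (S₂ₙ − S₁ₙ·h_{n+1})/(S₁ₙ − n·h_{n+1}) )·( ( (h_{n+1} − S₁ₙ/n)² + (2n+1)·Vₙ ) / ( S₁ₙ·(h_{n+1} − S₁ₙ/n)² + (n·h_{n+1} + (2n+1)·S₁ₙ)·Vₙ ) ); in particular this quantity is positive. -/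
open Matrix

/-- The variance `Vₘ` is positive as soon as two of the points differ. -/
theorem Vm_pos_of_lt {h : ℕ → ℝ} {m i j : ℕ} (hi : i < m) (hj : j < m) (hij : h i < h j) :
    0 < Vm h m := by
  have hm : (0 : ℝ) < m := by exact_mod_cast (by omega : 0 < m)
  set c := S1 h m / m with hc
  have hS1 : S1 h m = m * c := by rw [hc]; field_simp
  have hsum : ∑ k ∈ Finset.range m, (h k - c) ^ 2 = m * Vm h m := by
    have hexp : ∑ k ∈ Finset.range m, (h k - c) ^ 2 = S2 h m - 2 * c * S1 h m + m * c ^ 2 := by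
      simp only [S1, S2, sub_sq, Finset.sum_add_distrib, Finset.sum_sub_distrib, Finset.mul_sum,
        Finset.sum_const, Finset.card_range, nsmul_eq_mul]
      congr 2
      exact Finset.sum_congr rfl fun k _ => by ring
    rw [hexp, Vm, ← hc, hS1]
    field_simp
    ring
  have hpos : 0 < ∑ k ∈ Finset.range m, (h k - c) ^ 2 := by
    refine Finset.sum_pos' (fun k _ => sq_nonneg _) ?_
    by_cases hic : h i = c
    · exact ⟨j, Finset.mem_range.2 hj, pow_pos (by linarith) 2⟩
    · exact ⟨i, Finset.mem_range.2 hi, sq_pos_of_ne_zero (sub_ne_zero.2 hic)⟩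
  rw [hsum] at hpos
  exact pos_of_mul_pos_right hpos hm.le

/-- For `m` the mean, `d` the distance of the new point from it and `V` the variance,
`r₁₁ = m - V / d`. -/
theorem r11_eq {h : ℕ → ℝ} {n : ℕ} {m d V : ℝ} (hn : (n : ℝ) ≠ 0) (hS1 : S1 h n = n * m)
    (hS2 : S2 h n = n * (V + m ^ 2)) (hx : h n = m + d) (hVm : Vm h n = V)
    (hV : V ≠ 0) (hd : d ≠ 0) (hmd : m * d - V ≠ 0) : r11 h n = m - V / d := by
  have hq : qq h n = 1 + (d ^ 2 + V) / (n * V) := by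
    rw [qq, hS1, hx, hVm]; field_simp; ring
  have h1 : S1 h (n + 1) = n * m + (m + d) := by
    rw [← hx, ← hS1, S1, Finset.sum_range_succ, S1]
  have h2 : S2 h (n + 1) = n * (V + m ^ 2) + (m + d) ^ 2 := by
    rw [← hx, ← hS2, S2, Finset.sum_range_succ, S2]
  have hden : qq h n * S1 h n - S1 h (n + 1) = d * (m * d - V) / V := by
    rw [hq, h1, hS1]; field_simp; ring
  have hnum : qq h n * S2 h n - S2 h (n + 1) = (m - V / d) * (d * (m * d - V) / V) := by
    rw [hq, h2, hS2]; field_simp; ring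
  change (qq h n * S2 h n - S2 h (n + 1)) / (qq h n * S1 h n - S1 h (n + 1)) = _
  rw [hden, hnum]
  exact mul_div_cancel_right₀ _ (div_ne_zero (mul_ne_zero hd hmd) hV)

/-- For `m` the mean, `d` the distance of the new point from it and `V` the variance, an explicit
form of `r₁₂ - m`. -/
theorem r12_eq {h : ℕ → ℝ} {n : ℕ} {m d V : ℝ} (hn : (n : ℝ) ≠ 0) (hS1 : S1 h n = n * m)
    (hS2 : S2 h n = n * (V + m ^ 2)) (hx : h n = m + d) (hVm : Vm h n = V) (hV : V ≠ 0)
    (hD : m * d ^ 2 + (2 * (n + 1) * m + d) * V ≠ 0) :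
    r12 h n = m + V * (2 * d ^ 2 + (2 * n + 1) * V + m * d) /
      (m * d ^ 2 + (2 * (n + 1) * m + d) * V) := by
  have hq : qq h n = 1 + (d ^ 2 + V) / (n * V) := by
    rw [qq, hS1, hx, hVm]; field_simp; ring
  have h1 : S1 h (n + 1) = n * m + (m + d) := by
    rw [← hx, ← hS1, S1, Finset.sum_range_succ, S1]
  have h2 : S2 h (n + 1) = n * (V + m ^ 2) + (m + d) ^ 2 := by
    rw [← hx, ← hS2, S2, Finset.sum_range_succ, S2]
  have hden : qq h n * S1 h n + S1 h (n + 1) =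
      (m * d ^ 2 + (2 * (n + 1) * m + d) * V) / V := by
    rw [hq, h1, hS1]; field_simp; ring
  have hnum : qq h n * S2 h n + S2 h (n + 1) =
      (m * (m * d ^ 2 + (2 * (n + 1) * m + d) * V) +
        V * (2 * d ^ 2 + (2 * n + 1) * V + m * d)) / V := by
    rw [hq, h2, hS2]; field_simp; ring
  change (qq h n * S2 h n + S2 h (n + 1)) / (qq h n * S1 h n + S1 h (n + 1)) = _
  rw [hden, hnum, div_div_div_cancel_right₀ hV, add_div, mul_div_cancel_right₀ _ hD]

/-- Lemma A.4: closed form for `p̄₁(S₁ₙ/n) + Vₙ`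
for non-negative strictly increasing design points; in particular it is positive. -/
theorem barp1_at_mean_closed_form
    (n : ℕ) (hn : 2 ≤ n) (h : ℕ → ℝ)
    (hh0 : 0 ≤ h 0) (hhinc : ∀ i, i < n → h i < h (i + 1)) :
    (S1 h n / n - r11 h n) * (S1 h n / n - r12 h n) + Vm h n =
      (n : ℝ) * Vm h n * ((S2 h n - S1 h n * h n) / (S1 h n - n * h n)) *
        (((h n - S1 h n / n) ^ 2 + (2 * (n : ℝ) + 1) * Vm h n) /
          (S1 h n * (h n - S1 h n / n) ^ 2 +
            ((n : ℝ) * h n + (2 * (n : ℝ) + 1) * S1 h n) * Vm h n)) ∧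
    0 < (S1 h n / n - r11 h n) * (S1 h n / n - r12 h n) + Vm h n := by
  have hn0 : (0 : ℝ) < n := by exact_mod_cast (by omega : 0 < n)
  have hlt : ∀ j, j ≤ n → ∀ i, i < j → h i < h j := by
    intro j
    induction j with
    | zero => intro _ i hi; omega
    | succ k ih =>
      intro hk i hi
      rcases Nat.lt_succ_iff_lt_or_eq.1 hi with hik | rfl
      · exact (ih (by omega) i hik).trans (hhinc k (by omega))
      · exact hhinc i (by omega)
  have hnonneg : ∀ i, i ≤ n → 0 ≤ h i := by
    intro i hi
    rcases Nat.eq_zero_or_pos i with rfl | h0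
    · exact hh0
    · exact hh0.trans (hlt i hi 0 h0).le
  have hh1 : 0 < h 1 := hh0.trans_lt (hlt 1 (by omega) 0 one_pos)
  have hVpos : 0 < Vm h n :=
    Vm_pos_of_lt (by omega : 0 < n) (by omega : 1 < n) (hlt 1 (by omega) 0 one_pos)
  have hS1pos : 0 < S1 h n :=
    Finset.sum_pos' (fun i hi => hnonneg i (Finset.mem_range.1 hi).le)
      ⟨1, Finset.mem_range.2 (by omega), hh1⟩
  have hS1lt : S1 h n < n * h n := by
    have := Finset.sum_lt_sum_of_nonempty (Finset.nonempty_range_iff.2 (by omega : n ≠ 0))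
      (fun i hi => hlt n le_rfl i (Finset.mem_range.1 hi))
    simpa [S1] using this
  have hS2lt : S2 h n < S1 h n * h n := by
    rw [S1, S2, Finset.sum_mul]
    refine Finset.sum_lt_sum (fun i hi => ?_) ⟨1, Finset.mem_range.2 (by omega), ?_⟩
    · rw [sq]
      have hi' := Finset.mem_range.1 hi
      exact mul_le_mul_of_nonneg_left (hlt n le_rfl i hi').le (hnonneg i hi'.le)
    · rw [sq]
      exact mul_lt_mul_of_pos_left (hlt n le_rfl 1 (by omega)) hh1
  obtain ⟨V, hV⟩ : ∃ V, Vm h n = V := ⟨_, rfl⟩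
  obtain ⟨m, hm⟩ : ∃ m, S1 h n / n = m := ⟨_, rfl⟩
  obtain ⟨d, hd⟩ : ∃ d, h n - m = d := ⟨_, rfl⟩
  have hx : h n = m + d := by linarith
  have hS1 : S1 h n = n * m := by rw [← hm]; field_simp
  have hS2 : S2 h n = n * (V + m ^ 2) := by rw [← hV, Vm, hm]; field_simp; ring
  have hVp : 0 < V := hV ▸ hVpos
  have hmp : 0 < m := hm ▸ div_pos hS1pos hn0
  have hdp : 0 < d := by
    rw [hS1] at hS1lt
    linarith [lt_of_mul_lt_mul_left hS1lt hn0.le]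
  have hmd : 0 < m * d - V := by
    rw [hS1, hS2, hx, mul_assoc] at hS2lt
    linarith [lt_of_mul_lt_mul_left hS2lt hn0.le]
  have hD : 0 < m * d ^ 2 + (2 * (n + 1) * m + d) * V := by positivity
  have hclosed : (S1 h n / n - r11 h n) * (S1 h n / n - r12 h n) + Vm h n =
      (m * d - V) * (d ^ 2 + (2 * n + 1) * V) * V /
        (d * (m * d ^ 2 + (2 * (n + 1) * m + d) * V)) := by
    rw [r11_eq hn0.ne' hS1 hS2 hx hV hVp.ne' hdp.ne' hmd.ne',
      r12_eq hn0.ne' hS1 hS2 hx hV hVp.ne' hD.ne', hm, hV]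
    have := hD.ne'
    have hd0 := hdp.ne'
    field_simp
    ring
  rw [hclosed]
  refine ⟨?_, by positivity⟩
  have hfac : (S2 h n - S1 h n * h n) / (S1 h n - n * h n) = (m * d - V) / d := by
    have hne : S1 h n - n * h n ≠ 0 := by linarith
    rw [div_eq_div_iff hne hdp.ne', hS1, hS2, hx]
    ring
  have hden : S1 h n * d ^ 2 + (n * h n + (2 * n + 1) * S1 h n) * V =
      n * (m * d ^ 2 + (2 * (n + 1) * m + d) * V) := by
    rw [hS1, hx]; ring
  rw [hfac, hm, hd, hV, hden]
  have := hD.ne'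
  field_simp
end

section
/- Let 1 ≤ m < n and let r be a real number with S₁ₘ/m ≠ r and S₁,ₘ₊₁/(m+1) ≠ r. Then ( (S₁ₘ/m − r) + Vₘ/(S₁ₘ/m − r) ) − ( (S₁,ₘ₊₁/(m+1) − r) + V_{m+1}/(S₁,ₘ₊₁/(m+1) − r) ) = −( (h_{m+1} − r) / ( (m+1)·(S₁,ₘ₊₁/(m+1) − r) ) )·( h_{m+1} − (S₂ₘ − r·S₁ₘ)/(S₁ₘ − m·r) ). -/
open Matrix

/-- Away from the pole, `(S₁ₘ/m − r) + Vₘ/(S₁ₘ/m − r)` is the quotient of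
`∑ (hᵢ − r)²` by `∑ (hᵢ − r)`, both expanded in `S₁ₘ` and `S₂ₘ`. -/
lemma shifted_mean_add_Vm_div (h : ℕ → ℝ) {m : ℕ} (hm : m ≠ 0) {r : ℝ}
    (hr : S1 h m - m * r ≠ 0) :
    (S1 h m / m - r) + Vm h m / (S1 h m / m - r) =
      (S2 h m - 2 * r * S1 h m + m * r ^ 2) / (S1 h m - m * r) := by
  have hm' : (m : ℝ) ≠ 0 := Nat.cast_ne_zero.mpr hm
  have hmean : S1 h m / m - r = (S1 h m - m * r) / m := by field_simp
  rw [hmean, Vm]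
  field_simp
  ring

/-- Lemma A.5: the one-step update identity for
`(S₁ₘ/m − r) + Vₘ/(S₁ₘ/m − r)`.  The paper's `h_{m+1}` is `h m`. -/
theorem one_step_update_identity
    (n : ℕ) (hn : 2 ≤ n) (h : ℕ → ℝ) (m : ℕ) (hm1 : 1 ≤ m) (hmn : m < n)
    (r : ℝ) (hr1 : S1 h m / m ≠ r) (hr2 : S1 h (m + 1) / (m + 1) ≠ r) :
    ((S1 h m / m - r) + Vm h m / (S1 h m / m - r)) -
      ((S1 h (m + 1) / (m + 1) - r) + Vm h (m + 1) / (S1 h (m + 1) / (m + 1) - r)) =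
    -((h m - r) / (((m : ℝ) + 1) * (S1 h (m + 1) / (m + 1) - r))) *
      (h m - (S2 h m - r * S1 h m) / (S1 h m - m * r)) := by
  have hm : (m : ℝ) ≠ 0 := Nat.cast_ne_zero.mpr (by omega)
  have hm' : (m : ℝ) + 1 ≠ 0 := by positivity
  have hS1 : S1 h (m + 1) = S1 h m + h m := Finset.sum_range_succ _ _
  have hS2 : S2 h (m + 1) = S2 h m + h m ^ 2 := Finset.sum_range_succ _ _
  have hD : S1 h m - m * r ≠ 0 := fun h0 => hr1 (by rw [div_eq_iff hm]; linarith)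
  have hD' : S1 h m + h m - (m + 1) * r ≠ 0 := fun h0 =>
    hr2 (by rw [div_eq_iff hm', hS1]; linarith)
  have hden : ((m : ℝ) + 1) * (S1 h (m + 1) / (m + 1) - r) =
      S1 h m + h m - (m + 1) * r := by
    rw [hS1]
    field_simp
  have hsucc := shifted_mean_add_Vm_div h (m := m + 1) (r := r) m.succ_ne_zero
    (by rw [hS1]; exact_mod_cast hD')
  push_cast at hsucc
  rw [shifted_mean_add_Vm_div h (by omega) hD, hsucc, hden, hS1, hS2]
  rw [div_sub_div _ _ hD hD', sub_div' hD, neg_mul, div_mul_div_comm, ← neg_div,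
    div_eq_div_iff (mul_ne_zero hD hD') (mul_ne_zero hD' hD)]
  ring
end

section
/- Let 1 ≤ m ≤ n−1 and assume S₁ₘ − m·h_{m+1} ≠ 0 and S₁,ₘ₊₁ − (m+1)·h_{m+2} ≠ 0. Then (S₂,ₘ₊₁ − S₁,ₘ₊₁·h_{m+2})/(S₁,ₘ₊₁ − (m+1)·h_{m+2}) − (S₂ₘ − S₁ₘ·h_{m+1})/(S₁ₘ − m·h_{m+1}) = (h_{m+2} − h_{m+1})·( m·(S₁ₘ/m − h_{m+1})² + m(m+1)·Vₘ ) / ( (S₁ₘ − m·h_{m+1})·(S₁,ₘ₊₁ − (m+1)·h_{m+2}) ). -/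
open Matrix

/-- Lemma A.6: the increment identity for the sequence
`m ↦ (S₂ₘ − S₁ₘ h_{m+1})/(S₁ₘ − m h_{m+1})`.
The paper's `h_{m+1}`, `h_{m+2}` are `h m`, `h (m+1)`. -/
theorem r11_seq_increment_identity
    (n : ℕ) (hn : 2 ≤ n) (h : ℕ → ℝ) (m : ℕ) (hm1 : 1 ≤ m) (hmn : m < n)
    (hden1 : S1 h m - m * h m ≠ 0)
    (hden2 : S1 h (m + 1) - ((m : ℝ) + 1) * h (m + 1) ≠ 0) :
    (S2 h (m + 1) - S1 h (m + 1) * h (m + 1)) / (S1 h (m + 1) - ((m : ℝ) + 1) * h (m + 1)) -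
      (S2 h m - S1 h m * h m) / (S1 h m - m * h m) =
    (h (m + 1) - h m) *
      ((m : ℝ) * (S1 h m / m - h m) ^ 2 + (m : ℝ) * ((m : ℝ) + 1) * Vm h m) /
      ((S1 h m - m * h m) * (S1 h (m + 1) - ((m : ℝ) + 1) * h (m + 1))) := by
  have hm : (m : ℝ) ≠ 0 := Nat.cast_ne_zero.mpr (by lia)
  have hS1 : S1 h (m + 1) = S1 h m + h m := Finset.sum_range_succ _ _
  have hS2 : S2 h (m + 1) = S2 h m + h m ^ 2 := Finset.sum_range_succ _ _
  have hnum : (m : ℝ) * (S1 h m / m - h m) ^ 2 + (m : ℝ) * ((m : ℝ) + 1) * Vm h m =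
      ((m : ℝ) + 1) * S2 h m - S1 h m ^ 2 - 2 * S1 h m * h m + m * h m ^ 2 := by
    unfold Vm
    field_simp
    ring
  rw [hnum, div_sub_div _ _ hden2 hden1, mul_comm (S1 h m - m * h m), hS1, hS2]
  congr 1
  ring
end

section
/- Let Σ₁ be the (n+1)×(n+1) symmetric matrix with upper-left n×n block Σ₀ (an arbitrary symmetric positive definite matrix, not necessarily diagonal), last column (σ̄; σ_{n+1}²) and last row (σ̄ᵀ, σ_{n+1}²), where σ̄ ∈ ℝⁿ and σ_{n+1}² > 0; assume Σ₁ is invertible. Then V₁₁ = V₀₀ − σ_{n+1}²·W − W₁₁ + W₂₂, where W₂₂ = (A₁ᵀA₁)⁻¹·( aᵀσ̄ᵀA₀ + A₀ᵀσ̄a )·(A₁ᵀA₁)⁻¹ (with σ̄ regarded as an n×1 column vector and a as a 1×k row vector). -/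
open Matrix

/-- The Sherman–Morrison formula for the update of an invertible matrix by `u * v`, with `u` a
column and `v` a row. -/
theorem inv_sub_inv_add_col_mul_row {m K : Type*} [Fintype m] [DecidableEq m] [Field K]
    (G : Matrix m m K) (u : Matrix m (Fin 1) K) (v : Matrix (Fin 1) m K)
    (hG : IsUnit G.det) (hH : IsUnit (G + u * v).det) :
    (G + u * v)⁻¹ = G⁻¹ - (1 / (1 + (v * G⁻¹ * u) 0 0)) • (G⁻¹ * u * v * G⁻¹) := by
  set q : K := 1 + (v * G⁻¹ * u) 0 0 with hq
  have hscalar : u * (v * G⁻¹ * u) = (v * G⁻¹ * u) 0 0 • u := by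
    ext i j
    fin_cases j
    rw [mul_apply, Fin.sum_univ_one, Matrix.smul_apply, smul_eq_mul, mul_comm]
    rfl
  have hcol : G⁻¹ * u = q • ((G + u * v)⁻¹ * u) := by
    have h : (G + u * v) * (G⁻¹ * u) = q • u := by
      rw [Matrix.add_mul, mul_nonsing_inv_cancel_left _ _ hG, hq, add_smul, one_smul, ← hscalar]
      simp only [Matrix.mul_assoc]
    rw [← Matrix.mul_smul, ← h, nonsing_inv_mul_cancel_left _ _ hH]
  have hq0 : q ≠ 0 := by
    intro h
    rw [h, zero_smul] at hcol
    rw [Matrix.mul_assoc, hcol, Matrix.mul_zero, Matrix.zero_apply, add_zero] at hq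
    exact one_ne_zero (hq.symm.trans h)
  have hdiff : G⁻¹ - (G + u * v)⁻¹ = (G + u * v)⁻¹ * u * v * G⁻¹ := by
    have h : (G + u * v)⁻¹ * (G + u * v) * G⁻¹ = G⁻¹ := by
      rw [nonsing_inv_mul _ hH, Matrix.one_mul]
    rw [Matrix.mul_add, Matrix.add_mul, mul_nonsing_inv_cancel_right _ _ hG] at h
    rw [sub_eq_iff_eq_add', Matrix.mul_assoc _ u v]
    exact h.symm
  rw [hcol, Matrix.smul_mul, Matrix.smul_mul, smul_smul, one_div, inv_mul_cancel₀ hq0, one_smul,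
    ← hdiff, sub_sub_cancel]

/-- The quadratic form `Aᵀ * S * A`, expanded along the last row of `A` and the bordering of `S`. -/
theorem transpose_mul_mul_of_castSucc_last {n : ℕ} {m R : Type*} [CommRing R]
    (A₀ : Matrix (Fin n) m R) (a : Matrix (Fin 1) m R) (A₁ : Matrix (Fin (n + 1)) m R)
    (hcast : ∀ i j, A₁ (Fin.castSucc i) j = A₀ i j) (hlast : ∀ j, A₁ (Fin.last n) j = a 0 j)
    (S₀ : Matrix (Fin n) (Fin n) R) (s : Matrix (Fin n) (Fin 1) R) (c : R)
    (S₁ : Matrix (Fin (n + 1)) (Fin (n + 1)) R)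
    (hblock : ∀ i j, S₁ (Fin.castSucc i) (Fin.castSucc j) = S₀ i j)
    (hcol : ∀ i, S₁ (Fin.castSucc i) (Fin.last n) = s i 0)
    (hrow : ∀ j, S₁ (Fin.last n) (Fin.castSucc j) = s j 0)
    (hcorner : S₁ (Fin.last n) (Fin.last n) = c) :
    A₁ᵀ * S₁ * A₁ =
      A₀ᵀ * S₀ * A₀ + (aᵀ * sᵀ * A₀ + A₀ᵀ * s * a) + c • (aᵀ * a) := by
  ext i j
  simp only [mul_apply, transpose_apply, Matrix.add_apply, Matrix.smul_apply, smul_eq_mul,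
    Fin.sum_univ_castSucc (n := n), Fin.sum_univ_one, hcast, hlast, hblock, hcol, hrow, hcorner,
    add_mul, Finset.sum_add_distrib]
  ring

/-- Proposition A.9: decomposition of the OLS covariance in the
correlated case: `V₁₁ = V₀₀ − σ_{n+1}² • W − W₁₁ + W₂₂`. -/
theorem ols_variance_decomposition_correlated
    (n k : ℕ) (hn : 1 ≤ n) (hk : 1 ≤ k)
    (A₀ : Matrix (Fin n) (Fin k) ℝ) (a : Matrix (Fin 1) (Fin k) ℝ)
    (A₁ : Matrix (Fin (n + 1)) (Fin k) ℝ)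
    (hA₁cast : ∀ (i : Fin n) (j : Fin k), A₁ (Fin.castSucc i) j = A₀ i j)
    (hA₁last : ∀ j : Fin k, A₁ (Fin.last n) j = a 0 j)
    (hA₀full : IsUnit (A₀ᵀ * A₀).det) (hA₁full : IsUnit (A₁ᵀ * A₁).det)
    (Sig₀ : Matrix (Fin n) (Fin n) ℝ) (hSig₀ : Sig₀.PosDef)
    (sbar : Matrix (Fin n) (Fin 1) ℝ) (σlast : ℝ) (hσlast : 0 < σlast ^ 2)
    (Sig₁ : Matrix (Fin (n + 1)) (Fin (n + 1)) ℝ)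
    (hSig₁block : ∀ i j : Fin n,
        Sig₁ (Fin.castSucc i) (Fin.castSucc j) = Sig₀ i j)
    (hSig₁col : ∀ i : Fin n, Sig₁ (Fin.castSucc i) (Fin.last n) = sbar i 0)
    (hSig₁row : ∀ j : Fin n, Sig₁ (Fin.last n) (Fin.castSucc j) = sbar j 0)
    (hSig₁corner : Sig₁ (Fin.last n) (Fin.last n) = σlast ^ 2)
    (hSig₁inv : IsUnit Sig₁.det) :
    let V₀₀ := (A₀ᵀ * A₀)⁻¹ * A₀ᵀ * Sig₀ * A₀ * (A₀ᵀ * A₀)⁻¹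
    let V₁₁ := (A₁ᵀ * A₁)⁻¹ * A₁ᵀ * Sig₁ * A₁ * (A₁ᵀ * A₁)⁻¹
    let d : ℝ := (a * (A₀ᵀ * A₀)⁻¹ * aᵀ) 0 0
    let q : ℝ := 1 + d
    let W := (1 / q) • ((A₀ᵀ * A₀)⁻¹ * aᵀ * a * (A₀ᵀ * A₀)⁻¹)
    let D : Matrix (Fin n) (Fin n) ℝ :=
      Sig₀ - σlast ^ 2 • (1 : Matrix (Fin n) (Fin n) ℝ)
    let D₁₁ := A₀ᵀ * D * A₀
    let W₁₁ := (A₀ᵀ * A₀)⁻¹ * D₁₁ * (A₀ᵀ * A₀)⁻¹ - (A₁ᵀ * A₁)⁻¹ * D₁₁ * (A₁ᵀ * A₁)⁻¹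
    let W₂₂ := (A₁ᵀ * A₁)⁻¹ * (aᵀ * sbarᵀ * A₀ + A₀ᵀ * sbar * a) * (A₁ᵀ * A₁)⁻¹
    V₁₁ = V₀₀ - σlast ^ 2 • W - W₁₁ + W₂₂ := by
  intro V₀₀ V₁₁ d q W D D₁₁ W₁₁ W₂₂
  have hgram : A₁ᵀ * A₁ = A₀ᵀ * A₀ + aᵀ * a := by
    ext i j
    simp [mul_apply, Fin.sum_univ_castSucc, hA₁cast, hA₁last]
  have hmid := transpose_mul_mul_of_castSucc_last A₀ a A₁ hA₁cast hA₁last Sig₀ sbar (σlast ^ 2)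
    Sig₁ hSig₁block hSig₁col hSig₁row hSig₁corner
  have hinv : (A₁ᵀ * A₁)⁻¹ = (A₀ᵀ * A₀)⁻¹ - W := by
    rw [hgram] at hA₁full ⊢
    exact inv_sub_inv_add_col_mul_row _ _ _ hA₀full hA₁full
  have hD₁₁ : D₁₁ = A₀ᵀ * Sig₀ * A₀ - σlast ^ 2 • (A₀ᵀ * A₀) := by
    simp [D₁₁, D, Matrix.mul_sub, Matrix.sub_mul]
  have hV₁₁ : V₁₁ = (A₁ᵀ * A₁)⁻¹ * (A₁ᵀ * Sig₁ * A₁) * (A₁ᵀ * A₁)⁻¹ := by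
    simp only [V₁₁, Matrix.mul_assoc]
  have hV₀₀ : V₀₀ = (A₀ᵀ * A₀)⁻¹ * (A₀ᵀ * Sig₀ * A₀) * (A₀ᵀ * A₀)⁻¹ := by
    simp only [V₀₀, Matrix.mul_assoc]
  have hP : (A₀ᵀ * A₀)⁻¹ * (A₀ᵀ * A₀) * (A₀ᵀ * A₀)⁻¹ = (A₀ᵀ * A₀)⁻¹ := by
    rw [nonsing_inv_mul _ hA₀full, Matrix.one_mul]
  have hQ : (A₁ᵀ * A₁)⁻¹ * (aᵀ * a) * (A₁ᵀ * A₁)⁻¹ =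
      (A₀ᵀ * A₀)⁻¹ - W - (A₁ᵀ * A₁)⁻¹ * (A₀ᵀ * A₀) * (A₁ᵀ * A₁)⁻¹ := by
    rw [← hinv, eq_sub_iff_add_eq, ← Matrix.add_mul, ← Matrix.mul_add, add_comm (aᵀ * a), ← hgram,
      nonsing_inv_mul _ hA₁full, Matrix.one_mul]
  rw [hV₁₁, hmid, hV₀₀]
  simp only [W₁₁, W₂₂, hD₁₁]
  generalize aᵀ * sbarᵀ * A₀ + A₀ᵀ * sbar * a = C
  simp only [Matrix.mul_add, Matrix.add_mul, Matrix.mul_sub, Matrix.sub_mul, Matrix.mul_smul,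
    Matrix.smul_mul, hP, hQ, smul_sub]
  abel
end
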